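/- Let q be an odd prime power and let s ∈ SO_{2n+1}(q) be a semisimple element. Then there exist integers 0 ≤ k ≤ m ≤ n, an integer t ≥ 0, positive integers a_1,…,a_t and k_1,…,k_t with Σ_{i=1}^t k_i a_i = n − m, signs α_1,…,α_t ∈ {+,−} and a sign ε ∈ {+,−} such that C_{SO_{2n+1}(q)}(s) ≅ SO_{2k+1}(q) × O^ε_{2(m−k)}(q) × ∏_{i=1}^t GL^{α_i}_{a_i}(q^{k_i}) and C_{O_{2n+1}(q)}(s) ≅ O_{2k+1}(q) × O^ε_{2(m−k)}(q) × ∏_{i=1}^t GL^{α_i}_{a_i}(q^{k_i}). -/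

import Mathlib

open Matrix


section Orth

variable {F : Type} [Field F] {m : ℕ}

/-- The isometry group `O(Q)` of a quadratic form `Q` on `F^m`,
as a subgroup of `GL (Fin m) F`. -/
def isomGroup (Q : QuadraticForm F (Fin m → F)) : Subgroup (GL (Fin m) F) where
  carrier := {g | ∀ v, Q ((g : Matrix (Fin m) (Fin m) F) *ᵥ v) = Q v}
  one_mem' := by intro v; simp
  mul_mem' := by
    intro a b ha hb v
    rw [Units.val_mul, ← Matrix.mulVec_mulVec, ha, hb]
  inv_mem' := by
    intro a ha v
    have h := ha ((↑(a⁻¹) : Matrix (Fin m) (Fin m) F) *ᵥ v)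
    rw [Matrix.mulVec_mulVec, Units.mul_inv, Matrix.one_mulVec] at h
    exact h.symm

/-- The special isometry group `SO(Q)` (isometries of determinant `1`). -/
def sisomGroup (Q : QuadraticForm F (Fin m → F)) : Subgroup (GL (Fin m) F) :=
  isomGroup Q ⊓ (Matrix.GeneralLinearGroup.det : GL (Fin m) F →* Fˣ).ker

/-- Nondegeneracy of a quadratic form: no nonzero singular vector is in the radical of the
polar form. -/
def IsNondegQF (Q : QuadraticForm F (Fin m → F)) : Prop :=
  ∀ v, (∀ w, QuadraticMap.polar ⇑Q v w = 0) → Q v = 0 → v = 0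

/-- `Q` has Witt index `w`: `w` is the largest dimension of a totally singular subspace. -/
def HasWittIndex (Q : QuadraticForm F (Fin m → F)) (w : ℕ) : Prop :=
  IsGreatest {d : ℕ | ∃ W : Submodule F (Fin m → F),
    (∀ x ∈ W, Q x = 0) ∧ Module.finrank F ↥W = d} w

end Orth

/-- The fixed-point subgroup of a group endomorphism. -/
def MonoidHom.fixedSubgroup {G : Type*} [Group G] (f : G →* G) : Subgroup G where
  carrier := {g | f g = g}
  one_mem' := map_one f
  mul_mem' := by
    intro a b ha hb
    simp only [Set.mem_setOf_eq, _root_.map_mul] at *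
    rw [ha, hb]
  inv_mem' := by
    intro a ha
    simp only [Set.mem_setOf_eq, _root_.map_inv] at *
    rw [ha]

/-- The group endomorphism `g ↦ (g⁻¹)ᵀ` of `GL n K`. -/
def transposeInvHom (n K : Type*) [Fintype n] [DecidableEq n] [CommRing K] :
    GL n K →* GL n K where
  toFun g := ⟨(↑g⁻¹ : Matrix n n K)ᵀ, (↑g : Matrix n n K)ᵀ,
    by rw [← Matrix.transpose_mul, Units.mul_inv, Matrix.transpose_one],
    by rw [← Matrix.transpose_mul, Units.inv_mul, Matrix.transpose_one]⟩
  map_one' := by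
    apply Units.ext
    show ((↑(1 : GL n K)⁻¹ : Matrix n n K))ᵀ = (1 : Matrix n n K)
    simp
  map_mul' a b := by
    apply Units.ext
    show ((↑(a * b)⁻¹ : Matrix n n K))ᵀ =
      (↑a⁻¹ : Matrix n n K)ᵀ * (↑b⁻¹ : Matrix n n K)ᵀ
    rw [_root_.mul_inv_rev, Units.val_mul, Matrix.transpose_mul]

/-- The ring endomorphism `x ↦ x ^ (p ^ e)` of a commutative ring of characteristic `p`. -/
noncomputable def frobPow (K : Type*) [CommRing K] (p e : ℕ) [Fact p.Prime] [CharP K p] :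
    K →+* K := iterateFrobenius K p e

/-- The general unitary group `GU_a(p^e)`: the subgroup of `GL a K` for `K = F_{p^{2e}}`
consisting of the isometries of the standard nondegenerate Hermitian form on `K^a`, the
conjugation being `x ↦ x ^ (p ^ e)`.  (It is realized as the fixed-point subgroup of the
endomorphism `g ↦ ((g^σ)⁻¹)ᵀ` of `GL a K`, where `σ` is the entrywise conjugation.) -/
noncomputable def GUGroup (a p e : ℕ) [Fact p.Prime] :
    Subgroup (GL (Fin a) (GaloisField p (2 * e))) :=
  MonoidHom.fixedSubgroup
    ((transposeInvHom (Fin a) (GaloisField p (2 * e))).comp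
      (Units.map (RingHom.mapMatrix (frobPow (GaloisField p (2 * e)) p e)).toMonoidHom))

/-- `GLsign p true a e` is `GL_a(p^e)` and `GLsign p false a e` is `GU_a(p^e)`;
this is the group denoted `GL^{α}_a(p^e)` with `α = ±`. -/
noncomputable def GLsign (p : ℕ) [Fact p.Prime] : Bool → ℕ → ℕ → Type
  | true, a, e => GL (Fin a) (GaloisField p e)
  | false, a, e => ↥(GUGroup a p e)

noncomputable instance (p : ℕ) [Fact p.Prime] (α : Bool) (a e : ℕ) :
    Group (GLsign p α a e) := by
  cases α
  · exact inferInstanceAs (Group ↥(GUGroup a p e))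
  · exact inferInstanceAs (Group (GL (Fin a) (GaloisField p e)))

open Module Polynomial

section Split

variable {F U : Type} [Field F] [AddCommGroup U] [Module F U]

/-- The isometries of the bilinear form `B` that commute with the endomorphism `s`. -/
def centIsom (B : LinearMap.BilinForm F U) (s : Module.End F U) : Subgroup (U ≃ₗ[F] U) where
  carrier := {g | (∀ u v, B (g u) (g v) = B u v) ∧ ∀ u, g (s u) = s (g u)}
  one_mem' := by simp
  mul_mem' := by
    rintro a b ⟨ha, ha'⟩ ⟨hb, hb'⟩
    exact ⟨fun u v => by simp [ha, hb], fun u => by simp [ha', hb']⟩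
  inv_mem' := by
    rintro a ⟨ha, ha'⟩
    have key : ∀ u, a (a⁻¹ u) = u := fun u => a.apply_symm_apply u
    refine ⟨fun u v => ?_, fun u => ?_⟩
    · rw [← ha, key, key]
    · apply a.injective
      rw [ha', key, key]

theorem mem_centIsom {B : LinearMap.BilinForm F U} {s : Module.End F U} {g : U ≃ₗ[F] U} :
    g ∈ centIsom B s ↔ (∀ u v, B (g u) (g v) = B u v) ∧ ∀ u, g (s u) = s (g u) := Iff.rfl

/-- The restriction of a linear automorphism `g` to a submodule preserved by `g` and `g⁻¹`. -/
def restrictEquiv (W : Submodule F U) (g : U ≃ₗ[F] U) (h : ∀ w ∈ W, g w ∈ W)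
    (h' : ∀ w ∈ W, g⁻¹ w ∈ W) : W ≃ₗ[F] W :=
  LinearEquiv.ofLinearMap ((g : U →ₗ[F] U).restrict h) ((g⁻¹ : U ≃ₗ[F] U).toLinearMap.restrict h')
    (by ext w; exact g.apply_symm_apply w) (by ext w; exact g.symm_apply_apply w)

@[simp]
theorem coe_restrictEquiv (W : Submodule F U) (g : U ≃ₗ[F] U) (h : ∀ w ∈ W, g w ∈ W)
    (h' : ∀ w ∈ W, g⁻¹ w ∈ W) (w : W) : (restrictEquiv W g h h' w : U) = g w := rfl

/-- The automorphism of `U = W ⊕ W'` assembled from automorphisms of `W` and `W'`. -/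
noncomputable def glueEquiv {W W' : Submodule F U} (hc : IsCompl W W') (g : W ≃ₗ[F] W)
    (g' : W' ≃ₗ[F] W') : U ≃ₗ[F] U :=
  (Submodule.prodEquivOfIsCompl W W' hc).symm.trans
    ((g.prodCongr g').trans (Submodule.prodEquivOfIsCompl W W' hc))

theorem glueEquiv_add {W W' : Submodule F U} (hc : IsCompl W W') (g : W ≃ₗ[F] W)
    (g' : W' ≃ₗ[F] W') (w : W) (w' : W') :
    glueEquiv hc g g' ((w : U) + w') = (g w : U) + g' w' := by
  have : (Submodule.prodEquivOfIsCompl W W' hc).symm ((w : U) + w') = (w, w') := by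
    rw [LinearEquiv.symm_apply_eq, Submodule.coe_prodEquivOfIsCompl']
  simp [glueEquiv, this]

@[simp]
theorem glueEquiv_left {W W' : Submodule F U} (hc : IsCompl W W') (g : W ≃ₗ[F] W)
    (g' : W' ≃ₗ[F] W') (w : W) : glueEquiv hc g g' w = g w := by
  simpa using glueEquiv_add hc g g' w 0

@[simp]
theorem glueEquiv_right {W W' : Submodule F U} (hc : IsCompl W W') (g : W ≃ₗ[F] W)
    (g' : W' ≃ₗ[F] W') (w' : W') : glueEquiv hc g g' w' = g' w' := by
  simpa using glueEquiv_add hc g g' 0 w'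

theorem exists_add_of_isCompl {W W' : Submodule F U} (hc : IsCompl W W') (u : U) :
    ∃ (w : W) (w' : W'), u = w + w' := by
  obtain ⟨w, hw, w', hw', h⟩ := Submodule.mem_sup.1 (hc.sup_eq_top ▸ Submodule.mem_top (x := u))
  exact ⟨⟨w, hw⟩, ⟨w', hw'⟩, h.symm⟩

theorem det_glueEquiv [FiniteDimensional F U] {W W' : Submodule F U} (hc : IsCompl W W')
    (g : W ≃ₗ[F] W) (g' : W' ≃ₗ[F] W') :
    LinearEquiv.det (glueEquiv hc g g') = LinearEquiv.det g * LinearEquiv.det g' := by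
  apply Units.ext
  have : ((glueEquiv hc g g' : U ≃ₗ[F] U) : U →ₗ[F] U) =
      (Submodule.prodEquivOfIsCompl W W' hc : (W × W') →ₗ[F] U) ∘ₗ
        (LinearMap.prodMap (g : W →ₗ[F] W) (g' : W' →ₗ[F] W')) ∘ₗ
          ((Submodule.prodEquivOfIsCompl W W' hc).symm : U →ₗ[F] W × W') := rfl
  rw [LinearEquiv.coe_det, this, LinearMap.det_conj, LinearMap.det_prodMap, Units.val_mul,
    LinearEquiv.coe_det, LinearEquiv.coe_det]

theorem glueEquiv_restrictEquiv {W W' : Submodule F U} (hc : IsCompl W W') (g : U ≃ₗ[F] U) (h h')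
    (k k') : glueEquiv hc (restrictEquiv W g h h') (restrictEquiv W' g k k') = g := by
  ext u
  obtain ⟨w, w', rfl⟩ := exists_add_of_isCompl hc u
  simp [glueEquiv_add]

variable (B : LinearMap.BilinForm F U) (s : Module.End F U)

theorem restrictEquiv_mem_centIsom {W : Submodule F U} (hs : ∀ w ∈ W, s w ∈ W) {g : U ≃ₗ[F] U}
    (hg : g ∈ centIsom B s) (h h') :
    restrictEquiv W g h h' ∈ centIsom (B.restrict W) (s.restrict hs) :=
  ⟨fun u v => hg.1 u v, fun u => Subtype.ext (hg.2 u)⟩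

theorem glueEquiv_mem_centIsom {W W' : Submodule F U} (hc : IsCompl W W')
    (hsymm : ∀ u v, B u v = B v u) (horth : ∀ w ∈ W, ∀ w' ∈ W', B w w' = 0)
    (hs : ∀ w ∈ W, s w ∈ W) (hs' : ∀ w ∈ W', s w ∈ W') {g : W ≃ₗ[F] W} {g' : W' ≃ₗ[F] W'}
    (hg : g ∈ centIsom (B.restrict W) (s.restrict hs))
    (hg' : g' ∈ centIsom (B.restrict W') (s.restrict hs')) :
    glueEquiv hc g g' ∈ centIsom B s := by
  refine ⟨fun u v => ?_, fun u => ?_⟩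
  · obtain ⟨w, w', rfl⟩ := exists_add_of_isCompl hc u
    obtain ⟨x, x', rfl⟩ := exists_add_of_isCompl hc v
    have h1 := hg.1 w x
    have h2 := hg'.1 w' x'
    simp only [LinearMap.BilinForm.restrict_apply, LinearMap.domRestrict_apply] at h1 h2
    have e : ∀ (a b : W) (a' b' : W'), B (a + a') (b + b') = B a b + B a' b' := by
      intro a b a' b'
      simp [hsymm a' b, horth a a.2 b' b'.2, horth b b.2 a' a'.2]
    rw [glueEquiv_add, glueEquiv_add, e, e]
    exact congrArg₂ (· + ·) h1 h2
  · obtain ⟨w, w', rfl⟩ := exists_add_of_isCompl hc u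
    have h1 : (g ⟨s w, hs w w.2⟩ : U) = s (g w) := congrArg Subtype.val (hg.2 w)
    have h2 : (g' ⟨s w', hs' w' w'.2⟩ : U) = s (g' w') := congrArg Subtype.val (hg'.2 w')
    have := glueEquiv_add hc g g' ⟨s w, hs w w.2⟩ ⟨s w', hs' w' w'.2⟩
    rw [glueEquiv_add, map_add s, map_add s, ← h1, ← h2, ← this]

/-- If `U = W ⊕ W'` is an orthogonal decomposition into submodules invariant under everything that
commutes with `s`, then the group of isometries commuting with `s` decomposes as a product. -/
theorem exists_centIsom_mulEquiv_prod [FiniteDimensional F U] {W W' : Submodule F U}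
    (hc : IsCompl W W')
    (hsymm : ∀ u v, B u v = B v u) (horth : ∀ w ∈ W, ∀ w' ∈ W', B w w' = 0)
    (hs : ∀ w ∈ W, s w ∈ W) (hs' : ∀ w ∈ W', s w ∈ W')
    (hW : ∀ g ∈ centIsom B s, ∀ w ∈ W, g w ∈ W) (hW' : ∀ g ∈ centIsom B s, ∀ w ∈ W', g w ∈ W') :
    ∃ e : centIsom B s ≃*
        centIsom (B.restrict W) (s.restrict hs) × centIsom (B.restrict W') (s.restrict hs'),
      (∀ g : centIsom B s, LinearEquiv.det (g : U ≃ₗ[F] U) =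
        LinearEquiv.det ((e g).1 : W ≃ₗ[F] W) * LinearEquiv.det ((e g).2 : W' ≃ₗ[F] W')) ∧
      (∀ (g : centIsom B s) w, (((e g).1 : W ≃ₗ[F] W) w : U) = (g : U ≃ₗ[F] U) w) ∧
      ∀ (g : centIsom B s) w, (((e g).2 : W' ≃ₗ[F] W') w : U) = (g : U ≃ₗ[F] U) w := by
  have hi : ∀ g ∈ centIsom B s, ∀ w ∈ W, g⁻¹ w ∈ W := fun g hg => hW _ (inv_mem hg)
  have hi' : ∀ g ∈ centIsom B s, ∀ w ∈ W', g⁻¹ w ∈ W' := fun g hg => hW' _ (inv_mem hg)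
  refine ⟨{
    toFun := fun g =>
      (⟨restrictEquiv W g (hW g g.2) (hi g g.2), restrictEquiv_mem_centIsom B s hs g.2 _ _⟩,
       ⟨restrictEquiv W' g (hW' g g.2) (hi' g g.2), restrictEquiv_mem_centIsom B s hs' g.2 _ _⟩)
    invFun := fun g => ⟨glueEquiv hc g.1 g.2,
      glueEquiv_mem_centIsom B s hc hsymm horth hs hs' g.1.2 g.2.2⟩
    left_inv := fun g => Subtype.ext (glueEquiv_restrictEquiv hc _ _ _ _ _)
    right_inv := ?_
    map_mul' := ?_ }, fun g => ?_, fun g w => rfl, fun g w => rfl⟩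
  · rintro ⟨⟨g, hg⟩, ⟨g', hg'⟩⟩
    ext w <;> simp
  · rintro ⟨g, hg⟩ ⟨g', hg'⟩
    ext w <;> simp
  · conv_lhs => rw [← glueEquiv_restrictEquiv hc (g : U ≃ₗ[F] U) (hW g g.2) (hi g g.2) (hW' g g.2)
      (hi' g g.2), det_glueEquiv]
    rfl

end Split

section SemisimpleIsometry

variable {F U : Type} [Field F] [AddCommGroup U] [Module F U]

/-- `B` is a nondegenerate symmetric bilinear form and `s` is an isometry of `B` with `s ^ N = 1`,
where `N` is nonzero in the ground field. -/
structure IsSemisimpleIsom (B : LinearMap.BilinForm F U) (s : Module.End F U) (N : ℕ) : Prop where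
  symm : ∀ u v, B u v = B v u
  nondeg : ∀ u, (∀ v, B u v = 0) → u = 0
  isom : ∀ u v, B (s u) (s v) = B u v
  pow_eq_one : s ^ N = 1
  ne_zero : (N : F) ≠ 0

namespace IsSemisimpleIsom

variable {B : LinearMap.BilinForm F U} {s : Module.End F U} {N : ℕ}

theorem pos (h : IsSemisimpleIsom B s N) : 0 < N :=
  Nat.pos_of_ne_zero fun h0 => h.ne_zero (by simp [h0])

theorem apply_pow_pred (h : IsSemisimpleIsom B s N) (u : U) : s ((s ^ (N - 1)) u) = u := by
  have : s * s ^ (N - 1) = 1 := by rw [mul_pow_sub_one h.pos.ne', h.pow_eq_one]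
  exact LinearMap.congr_fun this u

theorem pow_pred_apply (h : IsSemisimpleIsom B s N) (u : U) : (s ^ (N - 1)) (s u) = u := by
  have : s ^ (N - 1) * s = 1 := by rw [pow_sub_one_mul h.pos.ne', h.pow_eq_one]
  exact LinearMap.congr_fun this u

theorem apply_left (h : IsSemisimpleIsom B s N) (u v : U) :
    B (s u) v = B u ((s ^ (N - 1)) v) := by
  rw [← h.isom u, h.apply_pow_pred]

theorem pow_apply_left (h : IsSemisimpleIsom B s N) (i : ℕ) (u v : U) :
    B ((s ^ i) u) v = B u (((s ^ (N - 1)) ^ i) v) := by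
  induction i generalizing u v with
  | zero => simp
  | succ i ih =>
    rw [pow_succ, pow_succ', Module.End.mul_apply, Module.End.mul_apply, ih, h.apply_left]

/-- The adjoint of `q(s)` is `q(s⁻¹)`. -/
theorem aeval_apply_left (h : IsSemisimpleIsom B s N) (q : F[X]) (u v : U) :
    B (aeval s q u) v = B u (aeval s (q.comp (X ^ (N - 1))) v) := by
  rw [aeval_comp, map_pow, aeval_X]
  induction q using Polynomial.induction_on' with
  | add p q hp hq => simp [hp, hq]
  | monomial n a =>
    simp [aeval_monomial, h.pow_apply_left, Module.algebraMap_end_apply]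

theorem isSemisimple [FiniteDimensional F U] (h : IsSemisimpleIsom B s N) : s.IsSemisimple := by
  refine Module.End.isSemisimple_of_squarefree_aeval_eq_zero
    (Polynomial.separable_X_pow_sub_C (1 : F) h.ne_zero one_ne_zero).squarefree ?_
  simp [h.pow_eq_one]

theorem isCompl_ker_range [FiniteDimensional F U] (h : IsSemisimpleIsom B s N) (q : F[X]) :
    IsCompl (LinearMap.ker (aeval s q)) (LinearMap.range (aeval s q)) := by
  have hss : (aeval s q).IsFinitelySemisimple := (h.isSemisimple.aeval q).isFinitelySemisimple
  have hd : Disjoint (LinearMap.ker (aeval s q)) (LinearMap.range (aeval s q)) := by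
    rw [Submodule.disjoint_def]
    rintro _ hx ⟨y, rfl⟩
    have hy : y ∈ (aeval s q).genEigenspace 0 (2 : ℕ) := by
      rw [Module.End.mem_genEigenspace_nat, LinearMap.mem_ker]
      simpa [pow_two] using hx
    rw [hss.genEigenspace_eq_eigenspace 0 (by norm_num), Module.End.mem_eigenspace_iff,
      zero_smul] at hy
    exact hy
  refine ⟨hd, codisjoint_iff.2 (Submodule.eq_top_of_disjoint _ _ ?_ hd)⟩
  rw [add_comm, LinearMap.finrank_range_add_finrank_ker]

theorem restrict [FiniteDimensional F U] (h : IsSemisimpleIsom B s N) {W W' : Submodule F U}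
    (hc : IsCompl W W') (horth : ∀ w ∈ W, ∀ w' ∈ W', B w w' = 0) (hs : ∀ w ∈ W, s w ∈ W) :
    IsSemisimpleIsom (B.restrict W) (s.restrict hs) N where
  symm u v := h.symm u v
  nondeg u hu := by
    apply Subtype.ext
    apply h.nondeg
    intro v
    obtain ⟨w, w', rfl⟩ := exists_add_of_isCompl hc v
    rw [map_add, horth u u.2 w' w'.2, add_zero]
    exact hu w
  isom u v := h.isom u v
  pow_eq_one := by
    ext w
    rw [Module.End.pow_restrict]
    simp [h.pow_eq_one]
  ne_zero := h.ne_zero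

/-- If `ker q(s) ≤ ker q(s⁻¹)`, then everything decomposes along `U = ker q(s) ⊕ range q(s)`. -/
theorem exists_split [FiniteDimensional F U] (h : IsSemisimpleIsom B s N) (q : F[X])
    (hq : LinearMap.ker (aeval s q) ≤ LinearMap.ker (aeval s (q.comp (X ^ (N - 1))))) :
    ∃ (hs : ∀ w ∈ LinearMap.ker (aeval s q), s w ∈ LinearMap.ker (aeval s q))
      (hs' : ∀ w ∈ LinearMap.range (aeval s q), s w ∈ LinearMap.range (aeval s q)),
      IsSemisimpleIsom (B.restrict (LinearMap.ker (aeval s q))) (s.restrict hs) N ∧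
      IsSemisimpleIsom (B.restrict (LinearMap.range (aeval s q))) (s.restrict hs') N ∧
      ∃ e : centIsom B s ≃* centIsom (B.restrict (LinearMap.ker (aeval s q))) (s.restrict hs) ×
          centIsom (B.restrict (LinearMap.range (aeval s q))) (s.restrict hs'),
        (∀ g : centIsom B s, LinearEquiv.det (g : U ≃ₗ[F] U) =
          LinearEquiv.det ((e g).1 : LinearMap.ker (aeval s q) ≃ₗ[F] LinearMap.ker (aeval s q)) *
            LinearEquiv.det
              ((e g).2 : LinearMap.range (aeval s q) ≃ₗ[F] LinearMap.range (aeval s q))) ∧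
        (∀ (g : centIsom B s) w, (((e g).1 : LinearMap.ker (aeval s q) ≃ₗ[F]
          LinearMap.ker (aeval s q)) w : U) = (g : U ≃ₗ[F] U) w) ∧
        ∀ (g : centIsom B s) w, (((e g).2 : LinearMap.range (aeval s q) ≃ₗ[F]
          LinearMap.range (aeval s q)) w : U) = (g : U ≃ₗ[F] U) w := by
  have hcomm : ∀ f : Module.End F U, Commute f s → Commute f (aeval s q) := fun f hf =>
    Algebra.commute_of_mem_adjoin_singleton_of_commute (R := F) (aeval_mem_adjoin_singleton F s) hf
  have hker : ∀ f : Module.End F U, Commute f s → ∀ w ∈ LinearMap.ker (aeval s q),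
      f w ∈ LinearMap.ker (aeval s q) := by
    intro f hf w hw
    rw [LinearMap.mem_ker] at hw ⊢
    have := LinearMap.congr_fun (hcomm f hf) w
    simp only [Module.End.mul_apply] at this
    rw [← this, hw, map_zero]
  have hran : ∀ f : Module.End F U, Commute f s → ∀ w ∈ LinearMap.range (aeval s q),
      f w ∈ LinearMap.range (aeval s q) := by
    rintro f hf _ ⟨w, rfl⟩
    exact ⟨f w, (LinearMap.congr_fun (hcomm f hf) w).symm⟩
  have hcent : ∀ g ∈ centIsom B s, Commute (g : Module.End F U) s := fun g hg =>
    LinearMap.ext hg.2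
  have hc := h.isCompl_ker_range q
  have horth : ∀ w ∈ LinearMap.ker (aeval s q), ∀ w' ∈ LinearMap.range (aeval s q),
      B w w' = 0 := by
    rintro w hw _ ⟨v, rfl⟩
    rw [h.symm, h.aeval_apply_left, LinearMap.mem_ker.1 (hq hw), map_zero]
  have horth' : ∀ w ∈ LinearMap.range (aeval s q), ∀ w' ∈ LinearMap.ker (aeval s q),
      B w w' = 0 := fun w hw w' hw' => by rw [h.symm, horth w' hw' w hw]
  exact ⟨hker s (Commute.refl s), hran s (Commute.refl s), h.restrict hc horth _,
    h.restrict hc.symm horth' _,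
    exists_centIsom_mulEquiv_prod B s hc h.symm horth _ _ (fun g hg => hker g (hcent g hg))
      (fun g hg => hran g (hcent g hg))⟩

end IsSemisimpleIsom

end SemisimpleIsometry

section FieldStructure

variable {F W : Type} [Field F] [AddCommGroup W] [Module F W]

/-- An endomorphism killed by an irreducible polynomial makes the space a vector space over the
extension of the ground field generated by a root of that polynomial. -/
theorem exists_module_adjoinRoot [Finite F] (s : Module.End F W) {π : F[X]} (hπ : Irreducible π)
    (h : aeval s π = 0) :
    ∃ (K : Type) (_ : Field K) (_ : Fintype K) (_ : Algebra F K) (_ : Module K W)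
      (_ : IsScalarTower F K W) (x : K), (∀ w : W, x • w = s w) ∧ Algebra.adjoin F {x} = ⊤ ∧
        ∀ y : K, aeval y π = 0 → ∃ σ : K →ₐ[F] K, σ x = y := by
  have : Fact (Irreducible π) := ⟨hπ⟩
  have hann : ∀ q ∈ Ideal.span {π}, (aeval s : F[X] →ₐ[F] Module.End F W).toRingHom q = 0 := by
    intro q hq
    obtain ⟨r, rfl⟩ := Ideal.mem_span_singleton'.1 hq
    simp [h]
  let φ : AdjoinRoot π →+* Module.End F W :=
    Ideal.Quotient.lift (Ideal.span {π}) (aeval s : F[X] →ₐ[F] Module.End F W).toRingHom hann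
  let _ : Module (AdjoinRoot π) W := Module.compHom W φ
  have hsmul : ∀ (q : F[X]) (w : W), AdjoinRoot.mk π q • w = aeval s q w := fun _ _ => rfl
  have htower : IsScalarTower F (AdjoinRoot π) W := by
    refine ⟨fun a c w => ?_⟩
    obtain ⟨q, rfl⟩ := AdjoinRoot.mk_surjective c
    rw [AdjoinRoot.smul_mk, hsmul, hsmul, map_smul, LinearMap.smul_apply]
  have : FiniteDimensional F (AdjoinRoot π) := (AdjoinRoot.powerBasis hπ.ne_zero).finite
  have : Finite (AdjoinRoot π) := Module.finite_of_finite F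
  refine ⟨AdjoinRoot π, inferInstance, Fintype.ofFinite _, inferInstance, inferInstance, htower,
    AdjoinRoot.root π, fun w => ?_, AdjoinRoot.adjoinRoot_eq_top, fun y hy => ?_⟩
  · rw [← AdjoinRoot.mk_X, hsmul, aeval_X]
  · refine ⟨AdjoinRoot.liftAlgHom π (Algebra.ofId F _) y (by simpa [aeval_def] using! hy), ?_⟩
    exact AdjoinRoot.liftAlgHom_root _ _ _ _

variable {K : Type} [Field K] [Module K W]

variable (K) in
/-- The `K`-linear isometries of an `F`-bilinear form on a `K`-vector space. -/
def linearIsom (B : LinearMap.BilinForm F W) : Subgroup (W ≃ₗ[K] W) where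
  carrier := {g | ∀ u v, B (g u) (g v) = B u v}
  one_mem' := by simp
  mul_mem' := by
    intro a b ha hb u v
    simp only [LinearEquiv.mul_apply]
    rw [ha, hb]
  inv_mem' := by
    intro a ha u v
    have key : ∀ u, a (a⁻¹ u) = u := fun u => a.apply_symm_apply u
    rw [← ha, key, key]

theorem mem_linearIsom {B : LinearMap.BilinForm F W} {g : W ≃ₗ[K] W} :
    g ∈ linearIsom K B ↔ ∀ u v, B (g u) (g v) = B u v := Iff.rfl

variable [Algebra F K] [IsScalarTower F K W]

theorem map_smul_of_adjoin_eq_top {s : Module.End F W} {x : K} (hx : ∀ w : W, x • w = s w)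
    (htop : Algebra.adjoin F {x} = ⊤) (g : W →ₗ[F] W) (hg : ∀ w, g (s w) = s (g w)) (c : K)
    (w : W) : g (c • w) = c • g w := by
  have hc : c ∈ Algebra.adjoin F {x} := htop ▸ Algebra.mem_top
  induction hc using Algebra.adjoin_induction generalizing w with
  | mem y hy =>
    obtain rfl : y = x := hy
    rw [hx, hx, hg]
  | algebraMap r => simp
  | add a b _ _ ha hb => simp [add_smul, ha, hb]
  | mul a b _ _ ha hb => simp [mul_smul, ha, hb]

theorem exists_centIsom_mulEquiv_linearIsom (B : LinearMap.BilinForm F W) {s : Module.End F W}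
    {x : K} (hx : ∀ w : W, x • w = s w) (htop : Algebra.adjoin F {x} = ⊤) :
    ∃ e : centIsom B s ≃* linearIsom K B,
      ∀ (g : centIsom B s) (w : W), (e g : W ≃ₗ[K] W) w = (g : W ≃ₗ[F] W) w := by
  refine ⟨{
    toFun := fun g => ⟨{ (g : W ≃ₗ[F] W) with
      map_smul' := map_smul_of_adjoin_eq_top hx htop (g : W ≃ₗ[F] W) g.2.2 }, g.2.1⟩
    invFun := fun g => ⟨(g : W ≃ₗ[K] W).restrictScalars F, g.2, fun w => ?_⟩
    left_inv := fun g => rfl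
    right_inv := fun g => rfl
    map_mul' := fun g h => rfl }, fun g w => rfl⟩
  simp [← hx]

/-- The matrix of a linear automorphism, with entries transported along a field isomorphism. -/
noncomputable def matrixEquiv {L : Type} [Field L] {a : ℕ} (b : Basis (Fin a) K W)
    (ψ : K ≃+* L) : (W ≃ₗ[K] W) ≃* GL (Fin a) L :=
  ((LinearMap.GeneralLinearGroup.generalLinearEquiv K W).symm.trans
    (Units.mapEquiv (LinearMap.toMatrixAlgEquiv b).toMulEquiv)).trans
      (Units.mapEquiv ψ.mapMatrix.toMulEquiv)

theorem matrixEquiv_apply {L : Type} [Field L] {a : ℕ} (b : Basis (Fin a) K W) (ψ : K ≃+* L)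
    (g : W ≃ₗ[K] W) (i j : Fin a) :
    (matrixEquiv b ψ g : Matrix (Fin a) (Fin a) L) i j = ψ (b.repr (g (b j)) i) := by
  simp [matrixEquiv, LinearMap.toMatrixAlgEquiv_apply]
  rfl

end FieldStructure

theorem exists_subgroup_mulEquiv {G H : Type*} [Group G] [Group H] (E : G ≃* H) (P : Subgroup G)
    (R : Subgroup H) (h : ∀ g, g ∈ P ↔ E g ∈ R) : ∃ e : P ≃* R, ∀ g : P, (e g : H) = E g := by
  refine ⟨{
    toFun := fun g => ⟨E g, (h g).1 g.2⟩
    invFun := fun g => ⟨E.symm g, (h _).2 (by simp)⟩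
    left_inv := fun g => Subtype.ext (E.symm_apply_apply _)
    right_inv := fun g => Subtype.ext (E.apply_symm_apply _)
    map_mul' := fun g g' => Subtype.ext (map_mul E _ _) }, fun g => rfl⟩

section DualPair

variable {F U : Type} [Field F] [AddCommGroup U] [Module F U] [FiniteDimensional F U]
variable {B : LinearMap.BilinForm F U} {s : Module.End F U} {N : ℕ}

namespace IsSemisimpleIsom

/-- A decomposition `U = W ⊕ W'` into totally isotropic subspaces identifies `W'` with the dual
of `W`. -/
theorem exists_dual_equiv (h : IsSemisimpleIsom B s N) {W W' : Submodule F U} (hc : IsCompl W W')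
    (hW : ∀ w ∈ W, ∀ x ∈ W, B w x = 0) (hW' : ∀ w ∈ W', ∀ x ∈ W', B w x = 0) :
    finrank F U = 2 * finrank F W ∧
      ∃ θ : W' ≃ₗ[F] Module.Dual F W, ∀ (w' : W') (w : W), θ w' w = B w' w := by
  have inj : ∀ {P P' : Submodule F U}, IsCompl P P' → (∀ w ∈ P', ∀ x ∈ P', B w x = 0) →
      Function.Injective (B.domRestrict₁₂ P' P) := by
    intro P P' hc hP'
    rw [injective_iff_map_eq_zero]
    intro w hw
    apply Subtype.ext
    apply h.nondeg
    intro u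
    obtain ⟨x, x', rfl⟩ := exists_add_of_isCompl hc u
    rw [map_add, hP' w w.2 x' x'.2, add_zero]
    exact LinearMap.congr_fun hw x
  have h1 := LinearMap.finrank_le_finrank_of_injective (inj hc hW')
  have h2 := LinearMap.finrank_le_finrank_of_injective (inj hc.symm hW)
  rw [Subspace.dual_finrank_eq] at h1 h2
  have h3 := Submodule.finrank_add_eq_of_isCompl hc
  refine ⟨by omega, LinearEquiv.ofInjectiveOfFinrankEq (B.domRestrict₁₂ W' W) (inj hc hW') ?_,
    fun w' w => rfl⟩
  rw [Subspace.dual_finrank_eq]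
  omega

/-- If `U = W ⊕ W'` with `W` and `W'` totally isotropic and invariant under the isometries
commuting with `s`, then restriction to `W` identifies this group of isometries with the
centralizer of `s|W` in the general linear group of `W`. -/
theorem exists_centIsom_mulEquiv_of_isotropic (h : IsSemisimpleIsom B s N)
    {W W' : Submodule F U} (hc : IsCompl W W')
    (hW : ∀ w ∈ W, ∀ x ∈ W, B w x = 0) (hW' : ∀ w ∈ W', ∀ x ∈ W', B w x = 0)
    (hs : ∀ w ∈ W, s w ∈ W) (hs' : ∀ w ∈ W', s w ∈ W')
    (hg : ∀ g ∈ centIsom B s, ∀ w ∈ W, g w ∈ W) (hg' : ∀ g ∈ centIsom B s, ∀ w ∈ W', g w ∈ W') :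
    Nonempty (centIsom B s ≃* centIsom (0 : LinearMap.BilinForm F W) (s.restrict hs)) ∧
      ∀ g ∈ centIsom B s, LinearEquiv.det g = 1 := by
  obtain ⟨-, θ, hθ⟩ := h.exists_dual_equiv hc hW hW'
  have hi : ∀ g ∈ centIsom B s, ∀ w ∈ W, g⁻¹ w ∈ W := fun g hg0 => hg _ (inv_mem hg0)
  have hi' : ∀ g ∈ centIsom B s, ∀ w ∈ W', g⁻¹ w ∈ W' := fun g hg0 => hg' _ (inv_mem hg0)
  have ext' : ∀ x y : W', (∀ w : W, B x w = B y w) → x = y := by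
    intro x y hxy
    apply θ.injective
    ext w
    rw [hθ, hθ, hxy]
  let c : (W ≃ₗ[F] W) → (W' ≃ₗ[F] W') := fun g => θ.trans (g.symm.dualMap.trans θ.symm)
  have hcB : ∀ (g : W ≃ₗ[F] W) (w' : W') (w : W), B (c g w') w = B w' (g.symm w) := by
    intro g w' w
    rw [← hθ, ← hθ]
    simp [c]
  have hdet : ∀ g : W ≃ₗ[F] W, LinearEquiv.det (c g) = (LinearEquiv.det g)⁻¹ := by
    intro g
    apply Units.ext
    rw [LinearEquiv.coe_inv_det, LinearEquiv.coe_det, ← LinearMap.det_dualMap (g.symm : W →ₗ[F] W),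
      ← LinearMap.det_conj (g.symm : W →ₗ[F] W).dualMap θ.symm]
    rfl
  have key : ∀ (g : U ≃ₗ[F] U) (hgc : g ∈ centIsom B s),
      glueEquiv hc (restrictEquiv W g (hg g hgc) (hi g hgc))
        (c (restrictEquiv W g (hg g hgc) (hi g hgc))) = g := by
    intro g hgc
    have : c (restrictEquiv W g (hg g hgc) (hi g hgc)) =
        restrictEquiv W' g (hg' g hgc) (hi' g hgc) := by
      apply LinearEquiv.ext
      intro w'
      apply ext'
      intro w
      rw [hcB, coe_restrictEquiv]
      have : g (g⁻¹ (w : U)) = w := g.apply_symm_apply _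
      calc B w' (g⁻¹ (w : U)) = B (g w') (g (g⁻¹ (w : U))) := (hgc.1 _ _).symm
        _ = B (g w') w := by rw [this]
    rw [this, glueEquiv_restrictEquiv]
  have hmem : ∀ g ∈ centIsom (0 : LinearMap.BilinForm F W) (s.restrict hs),
      glueEquiv hc g (c g) ∈ centIsom B s := by
    intro g hgs
    refine ⟨fun u v => ?_, fun u => ?_⟩
    · obtain ⟨w, w', rfl⟩ := exists_add_of_isCompl hc u
      obtain ⟨x, x', rfl⟩ := exists_add_of_isCompl hc v
      have e : ∀ (a b : W) (a' b' : W'), B (a + a') (b + b') = B b' a + B a' b := by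
        intro a b a' b'
        simp [hW a a.2 b b.2, hW' a' a'.2 b' b'.2, h.symm b' a, add_comm]
      rw [glueEquiv_add, glueEquiv_add, e, e, hcB, hcB]
      simp
    · obtain ⟨w, w', rfl⟩ := exists_add_of_isCompl hc u
      have h1 : ∀ w : W, (g ⟨s w, hs w w.2⟩ : U) = s (g w) := fun w =>
        congrArg Subtype.val (hgs.2 w)
      have h1' : ∀ w : W, (g.symm ⟨s w, hs w w.2⟩ : U) = s (g.symm w) := by
        intro w
        have : g.symm ⟨s w, hs w w.2⟩ = ⟨s (g.symm w), hs _ (g.symm w).2⟩ := by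
          rw [LinearEquiv.symm_apply_eq]
          apply Subtype.ext
          rw [h1]
          simp
        rw [this]
      have h2 : (c g ⟨s w', hs' w' w'.2⟩ : U) = s (c g w') := by
        have : c g ⟨s w', hs' w' w'.2⟩ = ⟨s (c g w'), hs' _ (c g w').2⟩ := by
          apply ext'
          intro x
          have hx : (s ^ (N - 1)) (x : U) ∈ W :=
            Module.End.pow_apply_mem_of_forall_mem (N - 1) hs x x.2
          have hx' : x = ⟨s ((s ^ (N - 1)) (x : U)), hs _ hx⟩ :=
            Subtype.ext (h.apply_pow_pred (x : U)).symm
          rw [hcB, hx', h1' ⟨_, hx⟩]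
          simp only [h.isom]
          exact (hcB g w' ⟨_, hx⟩).symm
        rw [this]
      have := glueEquiv_add hc g (c g) ⟨s w, hs w w.2⟩ ⟨s w', hs' w' w'.2⟩
      rw [glueEquiv_add, map_add s, map_add s, ← h1, ← h2, ← this]
  refine ⟨⟨{
    toFun := fun g => ⟨restrictEquiv W g.1 (hg g.1 g.2) (hi g.1 g.2),
      ⟨fun _ _ => rfl, (restrictEquiv_mem_centIsom B s hs g.2 _ _).2⟩⟩
    invFun := fun g => ⟨glueEquiv hc g.1 (c g.1), hmem g.1 g.2⟩
    left_inv := fun g => Subtype.ext (key g.1 g.2)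
    right_inv := ?_
    map_mul' := ?_ }⟩, fun g hgc => ?_⟩
  · rintro ⟨g, hg0⟩
    ext w
    simp
  · rintro ⟨g, hg0⟩ ⟨g', hg0'⟩
    ext w
    simp
  · rw [← key g hgc, det_glueEquiv, hdet, mul_inv_cancel]

end IsSemisimpleIsom

end DualPair

section FiniteFieldInvolution

variable {F K : Type} [Field F] [Field K] [Algebra F K] [Fintype F] [Fintype K]

theorem exists_involution_eq_pow (σ : K →ₐ[F] K) (h1 : ∃ x, σ x ≠ x) (h2 : ∀ x, σ (σ x) = x) :
    ∃ κ, 0 < κ ∧ finrank F K = 2 * κ ∧ ∀ x, σ x = x ^ Fintype.card F ^ κ := by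
  obtain ⟨i, hi⟩ := (FiniteField.bijective_frobeniusAlgHom_pow F K).2 σ
  have hσ : ∀ x, σ x = x ^ Fintype.card F ^ (i : ℕ) := by
    intro x
    rw [← hi]
    simp only [AlgHom.coe_pow, FiniteField.coe_frobeniusAlgHom]
    rw [pow_iterate]
  have hsq : FiniteField.frobeniusAlgHom F K ^ (2 * (i : ℕ)) = 1 := by
    rw [two_mul, pow_add]
    ext x
    simp only at hi
    rw [hi]
    exact h2 x
  have hdvd := orderOf_dvd_of_pow_eq_one hsq
  rw [FiniteField.orderOf_frobeniusAlgHom] at hdvd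
  have hi0 : 0 < (i : ℕ) := by
    rcases Nat.eq_zero_or_pos (i : ℕ) with h0 | h0
    · obtain ⟨x, hx⟩ := h1
      simp [hσ, h0] at hx
    · exact h0
  refine ⟨i, hi0, ?_, hσ⟩
  obtain ⟨c, hc⟩ := hdvd
  have hlt := i.2
  have hc2 : c < 2 := by
    by_contra hcon
    have : finrank F K * 2 ≤ finrank F K * c := Nat.mul_le_mul_left _ (by omega)
    omega
  interval_cases c
  · omega
  · omega

theorem exists_mul_involution_eq_one (σ : K →ₐ[F] K) (h1 : ∃ x, σ x ≠ x)
    (h2 : ∀ x, σ (σ x) = x) {h : K} (h0 : h ≠ 0) (hfix : σ h = h) : ∃ c, c * σ c * h = 1 := by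
  classical
  obtain ⟨κ, hκ, hrank, hσ⟩ := exists_involution_eq_pow σ h1 h2
  set r := Fintype.card F ^ κ with hr
  have hcard : Fintype.card K = r * r := by
    rw [Module.card_eq_pow_finrank (K := F) (V := K), hrank, two_mul, pow_add]
  have hr1 : 1 < r := Nat.one_lt_pow hκ.ne' Fintype.one_lt_card
  obtain ⟨g, hg⟩ := IsCyclic.exists_generator (α := Kˣ)
  have hord : orderOf g = r * r - 1 := by
    rw [orderOf_eq_card_of_forall_mem_zpowers hg, Nat.card_eq_fintype_card, Fintype.card_units,
      hcard]
  obtain ⟨j, hj⟩ : ∃ j : ℕ, g ^ j = (Units.mk0 h h0)⁻¹ :=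
    (mem_powers_iff_mem_zpowers (x := g)).2 (hg _)
  have hpow : (Units.mk0 h h0) ^ (r - 1) = 1 := by
    apply Units.ext
    have : h ^ (r - 1) * h = 1 * h := by
      rw [pow_sub_one_mul (by omega), ← hσ, hfix, one_mul]
    simpa using mul_right_cancel₀ h0 this
  have hdvd : r * r - 1 ∣ j * (r - 1) := by
    rw [← hord]
    apply orderOf_dvd_of_pow_eq_one
    rw [pow_mul, hj, inv_pow, hpow, inv_one]
  have hfac : r * r - 1 = (r + 1) * (r - 1) := by
    obtain ⟨t, ht⟩ : ∃ t, r = t + 1 := ⟨r - 1, by omega⟩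
    rw [ht, Nat.add_sub_cancel]
    have : (t + 1) * (t + 1) = (t + 1 + 1) * t + 1 := by ring
    omega
  rw [hfac] at hdvd
  obtain ⟨l, rfl⟩ := Nat.dvd_of_mul_dvd_mul_right (by omega) hdvd
  refine ⟨(g ^ l : Kˣ), ?_⟩
  have hgl : (g ^ l) * (g ^ l) ^ r * Units.mk0 h h0 = 1 := by
    have e : (g ^ l) * (g ^ l) ^ r = g ^ ((r + 1) * l) := by
      rw [← pow_mul, ← pow_add]
      congr 1
      ring
    rw [e, hj, inv_mul_cancel]
  rw [hσ]
  simpa using congrArg Units.val hgl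

theorem norm_eq_one_of_mul_involution (σ : K →ₐ[F] K) (h1 : ∃ x, σ x ≠ x)
    (h2 : ∀ x, σ (σ x) = x) {z : K} (hz : z * σ z = 1) : Algebra.norm F z = 1 := by
  by_cases hz1 : 1 + z = 0
  · obtain ⟨κ, -, hrank, -⟩ := exists_involution_eq_pow σ h1 h2
    have : z = algebraMap F K (-1) := by simp [eq_neg_of_add_eq_zero_right hz1]
    rw [this, Algebra.norm_algebraMap, hrank, pow_mul, neg_one_sq, one_pow]
  · have e : z * σ (1 + z) = 1 + z := by
      rw [map_add, map_one, mul_add, hz, mul_one, add_comm]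
    have hσN : Algebra.norm F (σ (1 + z)) = Algebra.norm F (1 + z) :=
      Algebra.norm_eq_of_algEquiv (AlgEquiv.ofBijective σ
        (Algebra.IsAlgebraic.algHom_bijective σ)) (1 + z)
    have hN := congrArg (Algebra.norm F) e
    rw [map_mul, hσN] at hN
    exact mul_right_cancel₀ (Algebra.norm_ne_zero_iff.2 hz1) (by rw [hN, one_mul])

theorem eq_of_forall_trace_mul_eq {x y : K}
    (hxy : ∀ c, Algebra.trace F K (c * x) = Algebra.trace F K (c * y)) : x = y := by
  apply (LinearMap.BilinForm.toDual (Algebra.traceForm F K)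
    (traceForm_nondegenerate F K)).injective
  ext c
  rw [LinearMap.BilinForm.toDual_def, LinearMap.BilinForm.toDual_def, Algebra.traceForm_apply,
    Algebra.traceForm_apply, mul_comm x, mul_comm y, hxy]

end FiniteFieldInvolution

section Hermitian

variable {F K U : Type} [Field F] [Field K] [Algebra F K] [Fintype F] [Fintype K]
variable [AddCommGroup U] [Module K U]

/-- A symmetric `F`-bilinear form with `B (c • u) v = B u (σ c • v)` is the trace of a Hermitian
form over `K`. -/
theorem exists_hermitian [Module F U] [IsScalarTower F K U] (σ : K →ₐ[F] K) (h2 : ∀ x, σ (σ x) = x) (B : LinearMap.BilinForm F U)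
    (hsymm : ∀ u v, B u v = B v u) (hσ : ∀ (c : K) u v, B (c • u) v = B u (σ c • v)) :
    ∃ H : U → (U →ₗ[K] K), (∀ c u v, Algebra.trace F K (c * H v u) = B (c • u) v) ∧
      ∀ u v, H u v = σ (H v u) := by
  have hnd := (traceForm_nondegenerate F K)
  have hex : ∀ u v : U, ∃ x : K, ∀ c, Algebra.trace F K (c * x) = B (c • u) v := by
    intro u v
    let φ : Module.Dual F K :=
      (B.flip v).comp ((LinearMap.toSpanSingleton K U u).restrictScalars F)
    refine ⟨(LinearMap.BilinForm.toDual (Algebra.traceForm F K) hnd).symm φ, fun c => ?_⟩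
    rw [mul_comm, ← Algebra.traceForm_apply, LinearMap.BilinForm.apply_toDual_symm_apply]
    rfl
  choose H hH using hex
  refine ⟨fun v => {
    toFun := fun u => H u v
    map_add' := fun u u' => eq_of_forall_trace_mul_eq (F := F) fun c => by rw [mul_add, map_add, hH, hH, hH]; simp
    map_smul' := fun d u => eq_of_forall_trace_mul_eq (F := F) fun c => by
      rw [hH, RingHom.id_apply, smul_eq_mul, ← mul_assoc, hH, mul_smul] },
    fun c u v => hH u v c, fun u v => eq_of_forall_trace_mul_eq (F := F) fun c => ?_⟩
  have htr : ∀ x, Algebra.trace F K (σ x) = Algebra.trace F K x := fun x =>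
    Algebra.trace_eq_of_algEquiv (AlgEquiv.ofBijective σ
      (Algebra.IsAlgebraic.algHom_bijective σ)) x
  calc Algebra.trace F K (c * H v u) = B (c • v) u := hH v u c
    _ = B (σ c • u) v := by rw [hσ, hsymm]
    _ = Algebra.trace F K (σ c * H u v) := (hH u v _).symm
    _ = Algebra.trace F K (σ (σ c * H u v)) := (htr _).symm
    _ = Algebra.trace F K (c * σ (H u v)) := by rw [map_mul, h2]

/-- A nondegenerate Hermitian form over a finite field of odd characteristic has an orthonormal
basis. -/
theorem exists_orthonormal_basis [FiniteDimensional K U] (σ : K →ₐ[F] K) (h1 : ∃ x, σ x ≠ x)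
    (h2 : ∀ x, σ (σ x) = x) (hchar : (2 : F) ≠ 0) (H : U → (U →ₗ[K] K))
    (hherm : ∀ u v, H u v = σ (H v u)) (hnd : ∀ u, (∀ v, H v u = 0) → u = 0) :
    ∃ b : Basis (Fin (finrank K U)) K U, ∀ i j, H (b i) (b j) = if i = j then 1 else 0 := by
  have hadd : ∀ u v w, H (u + v) w = H u w + H v w := fun u v w => by
    rw [hherm, map_add, map_add, ← hherm, ← hherm]
  have hsmul : ∀ (c : K) u w, H (c • u) w = σ c * H u w := fun c u w => by
    rw [hherm, map_smul, smul_eq_mul, map_mul, ← hherm]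
  have hproj : ∀ {k : ℕ} (v : Fin k → U), (∀ i j, H (v i) (v j) = if i = j then 1 else 0) →
      ∀ u j, H (v j) (u - ∑ i, H (v i) u • v i) = 0 := by
    intro k v hv u j
    rw [map_sub, map_sum]
    simp [hv]
  have main : ∀ k ≤ finrank K U, ∃ v : Fin k → U,
      ∀ i j, H (v i) (v j) = if i = j then 1 else 0 := by
    intro k
    induction k with
    | zero => exact fun _ => ⟨Fin.elim0, fun i => i.elim0⟩
    | succ k ih =>
      intro hk
      obtain ⟨v, hv⟩ := ih (by omega)
      obtain ⟨u, hu⟩ : ∃ u, u ∉ Submodule.span K (Set.range v) := by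
        by_contra! hcon
        have htop : Submodule.span K (Set.range v) = ⊤ := by
          rw [eq_top_iff]
          exact fun u _ => hcon u
        have := finrank_range_le_card (R := K) v
        rw [Set.finrank, htop, finrank_top, Fintype.card_fin] at this
        omega
      have horth : ∀ w w', (∀ i, H (v i) w = 0) →
          H (w' - ∑ i, H (v i) w' • v i) w = H w' w := by
        intro w w' hw
        have h0 : ∀ i, H w (v i) = 0 := fun i => by rw [hherm, hw, map_zero]
        rw [hherm, hherm w' w, map_sub (H w), map_sum (H w)]
        simp [h0]
      obtain ⟨w, hw0, hw⟩ : ∃ w, w ≠ 0 ∧ ∀ i, H (v i) w = 0 := by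
        refine ⟨u - ∑ i, H (v i) u • v i, fun h0 => hu ?_, hproj v hv u⟩
        rw [sub_eq_zero.1 h0]
        exact Submodule.sum_mem _ fun i _ =>
          Submodule.smul_mem _ _ (Submodule.subset_span ⟨i, rfl⟩)
      obtain ⟨x, hx0, hx⟩ : ∃ x, H x x ≠ 0 ∧ ∀ i, H (v i) x = 0 := by
        by_contra! hcon
        have hiso : ∀ x, (∀ i, H (v i) x = 0) → H x x = 0 := by
          intro x hx
          by_contra h0
          obtain ⟨i, hi⟩ := hcon x h0
          exact hi (hx i)
        apply hw0
        apply hnd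
        intro w'
        by_contra hne
        set w'' := w' - ∑ i, H (v i) w' • v i with hw''
        have e1 : H w'' w = H w' w := horth w w' hw
        have hw''0 : ∀ i, H (v i) w'' = 0 := hproj v hv w'
        set y := (H w' w)⁻¹ • w with hy
        have hy0 : ∀ i, H (v i) y = 0 := fun i => by simp [hy, hw]
        have e2 : H w'' y = 1 := by
          rw [hy, map_smul, e1, smul_eq_mul, inv_mul_cancel₀ hne]
        have e3 : H y w'' = 1 := by rw [hherm, e2, map_one]
        have e4 := hiso (y + w'') fun i => by rw [map_add, hy0, hw''0, add_zero]
        rw [hadd, map_add, map_add, hiso y hy0, hiso w'' hw''0, e2, e3] at e4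
        have : algebraMap F K 2 = 0 := by
          rw [map_ofNat]
          linear_combination e4
        exact hchar ((map_eq_zero _).1 this)
      obtain ⟨c, hc⟩ := exists_mul_involution_eq_one σ h1 h2 hx0 (hherm x x).symm
      have hcx : H (c • x) (c • x) = 1 := by
        rw [hsmul, map_smul, smul_eq_mul, ← hc]
        ring
      refine ⟨Fin.cons (c • x) v, fun i j => ?_⟩
      refine Fin.cases ?_ (fun i => ?_) i <;> refine Fin.cases ?_ (fun j => ?_) j
      · simpa using hcx
      · rw [if_neg (Fin.succ_ne_zero j).symm]
        simp [hsmul, hherm x, hx]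
      · rw [if_neg (Fin.succ_ne_zero i)]
        simp [hx]
      · simp [hv]
  obtain ⟨v, hv⟩ := main _ le_rfl
  have hli : LinearIndependent K v := by
    rw [Fintype.linearIndependent_iff]
    intro g hg i
    have := congrArg (H (v i)) hg
    simpa [hv] using this
  refine ⟨basisOfLinearIndependentOfCardEqFinrank' v hli (by simp), fun i j => ?_⟩
  simpa using hv i j

end Hermitian

theorem mem_GUGroup_iff {a p e : ℕ} [Fact p.Prime] (M : GL (Fin a) (GaloisField p (2 * e))) :
    M ∈ GUGroup a p e ↔
      ∀ i j, ∑ k, M.val k i *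
        M.val k j ^ p ^ e = if i = j then 1 else 0 := by
  set N : GL (Fin a) (GaloisField p (2 * e)) :=
    Units.map (RingHom.mapMatrix (frobPow (GaloisField p (2 * e)) p e)).toMonoidHom M with hN
  have hNapp : ∀ i j, N.val i j =
      M.val i j ^ p ^ e := by
    simp [hN, frobPow, iterateFrobenius_def]
  have h1 : M ∈ GUGroup a p e ↔ M.valᵀ * N.val = 1 := by
    have : M ∈ GUGroup a p e ↔ transposeInvHom _ _ N = M := Iff.rfl
    rw [this, Units.ext_iff]
    change (N⁻¹).valᵀ = _ ↔ _
    constructor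
    · intro h
      rw [← h, Matrix.transpose_transpose, Units.inv_mul]
    · intro h
      rw [Units.inv_eq_of_mul_eq_one_left h, Matrix.transpose_transpose]
  rw [h1, ← Matrix.ext_iff]
  simp [Matrix.mul_apply, hNapp, Matrix.one_apply]

section Unitary

variable {F U : Type} [Field F] [Fintype F] [AddCommGroup U] [Module F U] [FiniteDimensional F U]

theorem exists_centIsom_mulEquiv_GUGroup [Nontrivial U] {B : LinearMap.BilinForm F U}
    {s : Module.End F U} {N p f : ℕ} [Fact p.Prime] (hF : Fintype.card F = p ^ f)
    (h : IsSemisimpleIsom B s N) (hchar : (2 : F) ≠ 0) {π : F[X]} (hπ : Irreducible π)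
    (hdvd : π ∣ π.comp (X ^ (N - 1))) (hs : aeval s π = 0) (hne : ∀ u, s (s u) = u → u = 0) :
    ∃ κ a, 0 < κ ∧ 0 < a ∧ finrank F U = 2 * (κ * a) ∧
      Nonempty (centIsom B s ≃* GUGroup a p (f * κ)) ∧
      ∀ g ∈ centIsom B s, LinearEquiv.det g = 1 := by
  obtain ⟨K, _, _, _, _, _, x, hx, htop, hlift⟩ := exists_module_adjoinRoot s hπ hs
  obtain ⟨u₀, hu₀⟩ := exists_ne (0 : U)
  have haeval : ∀ (q : F[X]) (u : U), aeval x q • u = aeval s q u := by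
    intro q u
    have : s = Algebra.lsmul F F U x := LinearMap.ext fun w => (hx w).symm
    rw [this, aeval_algHom_apply]
    rfl
  have hx1 : x * x ^ (N - 1) = 1 := by
    rw [mul_pow_sub_one h.pos.ne']
    have := haeval (X ^ N - 1) u₀
    simp only [map_sub, map_pow, aeval_X, map_one, h.pow_eq_one, sub_self,
      LinearMap.zero_apply] at this
    exact sub_eq_zero.1 ((smul_eq_zero.1 this).resolve_right hu₀)
  have hroot : aeval x π = 0 := by
    have := haeval π u₀
    rw [hs, LinearMap.zero_apply] at this
    exact (smul_eq_zero.1 this).resolve_right hu₀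
  obtain ⟨σ, hσx⟩ := hlift (x ^ (N - 1)) (by
    obtain ⟨r, hr⟩ := hdvd
    have := congrArg (aeval x) hr
    rwa [aeval_comp, map_mul, hroot, zero_mul, map_pow, aeval_X] at this)
  have h2 : ∀ c, σ (σ c) = c := by
    have : σ.comp σ = AlgHom.id F K := by
      refine AlgHom.ext_of_adjoin_eq_top htop ?_
      rintro y rfl
      have e := congrArg σ hx1
      rw [map_mul, map_one, hσx, mul_comm] at e
      have hy : y ^ (N - 1) ≠ 0 := right_ne_zero_of_mul_eq_one hx1
      simp only [AlgHom.comp_apply, hσx, AlgHom.id_apply]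
      exact mul_right_cancel₀ hy (e.trans hx1.symm)
    exact fun c => DFunLike.congr_fun this c
  have h1 : ∃ c, σ c ≠ c := by
    refine ⟨x, fun e => hu₀ (hne u₀ ?_)⟩
    rw [← hx, ← hx, smul_smul]
    nth_rw 2 [← e]
    rw [hσx, hx1, one_smul]
  have hadj : ∀ (c : K) u v, B (c • u) v = B u (σ c • v) := by
    intro c
    have hc : c ∈ Algebra.adjoin F {x} := htop ▸ Algebra.mem_top
    induction hc using Algebra.adjoin_induction with
    | mem y hy =>
      obtain rfl : y = x := hy
      intro u v
      have := haeval (X ^ (N - 1)) v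
      simp only [map_pow, aeval_X] at this
      rw [hx, h.apply_left, hσx, this]
    | algebraMap r => simp
    | add a b _ _ ha hb => simp [add_smul, ha, hb]
    | mul a b _ _ ha hb =>
      intro u v
      rw [mul_smul, ha, hb, smul_smul, map_mul, mul_comm]
  obtain ⟨H, hH, hherm⟩ := exists_hermitian σ h2 B h.symm hadj
  have : FiniteDimensional K U := FiniteDimensional.right F K U
  have : FiniteDimensional F K := Module.Finite.of_finite
  have hnd : ∀ u, (∀ v, H v u = 0) → u = 0 := fun u hu => h.nondeg u fun v => by
    have := hH 1 u v
    rw [hu, mul_zero, map_zero, one_smul] at this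
    exact this.symm
  obtain ⟨b, hb⟩ := exists_orthonormal_basis σ h1 h2 hchar H hherm hnd
  obtain ⟨κ, hκ, hrank, hσ⟩ := exists_involution_eq_pow σ h1 h2
  have hp : 1 < p := (Fact.out : p.Prime).one_lt
  have hf : 0 < f := by
    rcases Nat.eq_zero_or_pos f with h0 | h0
    · have := Fintype.one_lt_card (α := F)
      rw [hF, h0] at this
      simp at this
    · exact h0
  have hrepr : ∀ u i, b.repr u i = H (b i) u := by
    intro u i
    conv_rhs => rw [← b.sum_repr u, map_sum]
    simp [hb, -Basis.sum_repr]
  have hHrepr : ∀ u v, H v u = ∑ k, H (b k) u * σ (H (b k) v) := by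
    intro u v
    conv_lhs => rw [← b.sum_repr u, map_sum]
    refine Finset.sum_congr rfl fun k _ => ?_
    rw [map_smul, smul_eq_mul, hrepr, hherm v]
  have hmem : ∀ g : U ≃ₗ[K] U, g ∈ linearIsom K B ↔ 
      ∀ i j, ∑ k, H (b k) (g (b i)) * σ (H (b k) (g (b j))) = if i = j then 1 else 0 := by
    intro g
    simp only [← hHrepr]
    constructor
    · intro hg i j
      have : H (g (b j)) (g (b i)) = H (b j) (b i) := by
        refine eq_of_forall_trace_mul_eq (F := F) fun c => ?_
        rw [hH, hH, ← map_smul, hg]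
      rw [this, hb]
      simp [eq_comm]
    · intro hg
      have e1 : ∀ j u, H (g (b j)) (g u) = H (b j) u := by
        intro j u
        have : (H (g (b j))).comp (g : U →ₗ[K] U) = H (b j) :=
          b.ext fun i => by simp [hg, hb, eq_comm]
        exact LinearMap.congr_fun this u
      have e2 : ∀ v u, H (g v) (g u) = H v u := by
        intro v u
        have : (H (g v)).comp (g : U →ₗ[K] U) = H v :=
          b.ext fun i => by simp [hherm (g v), e1, ← hherm]
        exact LinearMap.congr_fun this u
      intro u v
      have h3 := hH 1 (g u) (g v)
      rw [e2, hH, one_smul, one_smul] at h3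
      exact h3.symm
  obtain ⟨e₁, he₁⟩ := exists_centIsom_mulEquiv_linearIsom B hx htop
  let _ : Fintype (GaloisField p (2 * (f * κ))) := Fintype.ofFinite _
  have hcard : Fintype.card K = Fintype.card (GaloisField p (2 * (f * κ))) := by
    rw [Module.card_eq_pow_finrank (K := F) (V := K), hrank, hF, ← Nat.card_eq_fintype_card,
      GaloisField.card _ _ (by positivity), ← pow_mul]
    congr 1
    ring
  let ψ : K ≃+* GaloisField p (2 * (f * κ)) := FiniteField.ringEquivOfCardEq hcard
  have hmem' : ∀ g : U ≃ₗ[K] U, g ∈ linearIsom K B ↔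
      matrixEquiv b ψ g ∈ GUGroup (finrank K U) p (f * κ) := by
    intro g
    rw [hmem, mem_GUGroup_iff]
    refine forall₂_congr fun i j => ?_
    rw [← ψ.injective.eq_iff]
    simp only [matrixEquiv_apply, hrepr, map_sum, map_mul, hσ, map_pow, hF, pow_mul]
    rw [apply_ite ψ, map_one, map_zero]
  obtain ⟨e₂, -⟩ := exists_subgroup_mulEquiv (matrixEquiv b ψ) _ _ hmem'
  refine ⟨κ, finrank K U, hκ, finrank_pos, ?_, ⟨e₁.trans e₂⟩, fun g hg => ?_⟩
  · rw [← finrank_mul_finrank F K U, hrank, mul_assoc]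
  · set g' := e₁ ⟨g, hg⟩ with hg'
    have e1 : (g : U →ₗ[F] U) = ((g' : U ≃ₗ[K] U) : U →ₗ[K] U).restrictScalars F :=
      LinearMap.ext fun w => (he₁ ⟨g, hg⟩ w).symm
    apply Units.ext
    rw [LinearEquiv.coe_det, e1, LinearMap.det_restrictScalars]
    apply norm_eq_one_of_mul_involution σ h1 h2
    rw [← LinearMap.det_toMatrix b]
    set M := LinearMap.toMatrix b b ((g' : U ≃ₗ[K] U) : U →ₗ[K] U) with hM
    have hMapp : ∀ i j, M i j = H (b i) ((g' : U ≃ₗ[K] U) (b j)) := fun i j => by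
      rw [hM, LinearMap.toMatrix_apply, hrepr]
      rfl
    have hMM : Mᵀ * M.map σ = 1 := by
      ext i j
      rw [Matrix.mul_apply, Matrix.one_apply, ← (hmem g').1 g'.2 i j]
      simp [hMapp]
    have := congrArg Matrix.det hMM
    rwa [Matrix.det_mul, Matrix.det_transpose, Matrix.det_one, ← AlgHom.mapMatrix_apply,
      ← AlgHom.map_det] at this

end Unitary

section LinearCase

variable {F W : Type} [Field F] [AddCommGroup W] [Module F W]

theorem coe_aeval_restrict {s : Module.End F W} {V : Submodule F W} (hs : ∀ w ∈ V, s w ∈ V)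
    (q : F[X]) (w : V) : (aeval (s.restrict hs) q w : W) = aeval s q w := by
  induction q using Polynomial.induction_on' with
  | add p q hp hq => simp [hp, hq]
  | monomial n a =>
    have : (((s.restrict hs) ^ n) w : W) = (s ^ n) w := by
      rw [Module.End.pow_restrict]
      rfl
    simp [aeval_monomial, Module.algebraMap_end_apply, this]

theorem exists_centIsom_zero_mulEquiv_GL [Fintype F] [FiniteDimensional F W] [Nontrivial W]
    {p f : ℕ} [Fact p.Prime] (hF : Fintype.card F = p ^ f) {s : Module.End F W} {π : F[X]}
    (hπ : Irreducible π) (hs : aeval s π = 0) :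
    ∃ κ a, 0 < κ ∧ 0 < a ∧ finrank F W = κ * a ∧
      Nonempty (centIsom (0 : LinearMap.BilinForm F W) s ≃*
        GL (Fin a) (GaloisField p (f * κ))) := by
  obtain ⟨K, _, _, _, _, _, x, hx, htop, -⟩ := exists_module_adjoinRoot s hπ hs
  have : FiniteDimensional K W := FiniteDimensional.right F K W
  have : FiniteDimensional F K := Module.Finite.of_finite
  have hf : f ≠ 0 := by
    rintro rfl
    exact (Fintype.one_lt_card (α := F)).ne' (by simpa using hF)
  have hκ : 0 < finrank F K := finrank_pos
  let _ : Fintype (GaloisField p (f * finrank F K)) := Fintype.ofFinite _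
  have hcard : Fintype.card K = Fintype.card (GaloisField p (f * finrank F K)) := by
    rw [Module.card_eq_pow_finrank (K := F) (V := K), hF, ← Nat.card_eq_fintype_card,
      GaloisField.card _ _ (by positivity), ← pow_mul]
  obtain ⟨e, -⟩ :=
    exists_centIsom_mulEquiv_linearIsom (0 : LinearMap.BilinForm F W) hx htop
  obtain ⟨e', -⟩ := exists_subgroup_mulEquiv
    (matrixEquiv (finBasis K W) (FiniteField.ringEquivOfCardEq hcard))
    (linearIsom K (0 : LinearMap.BilinForm F W)) ⊤ fun g => by simp [mem_linearIsom]
  exact ⟨finrank F K, finrank K W, hκ, finrank_pos, (finrank_mul_finrank F K W).symm,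
    ⟨(e.trans e').trans Subgroup.topEquiv⟩⟩

end LinearCase

section Blocks

variable {F : Type} [Field F]

theorem ker_aeval_le_ker_aeval_of_dvd {U : Type} [AddCommGroup U] [Module F U] (s : Module.End F U)
    {q r : F[X]} (h : q ∣ r) : LinearMap.ker (aeval s q) ≤ LinearMap.ker (aeval s r) := by
  obtain ⟨c, rfl⟩ := h
  intro u hu
  rw [LinearMap.mem_ker] at hu ⊢
  rw [mul_comm, map_mul, Module.End.mul_apply, hu, map_zero]

theorem exists_irreducible_ker_aeval_ne_bot {U : Type} [AddCommGroup U] [Module F U]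
    [FiniteDimensional F U] [Nontrivial U] (s : Module.End F U) :
    ∃ π : F[X], Irreducible π ∧ LinearMap.ker (aeval s π) ≠ ⊥ := by
  have hintegral : IsIntegral F s := Algebra.IsIntegral.isIntegral s
  obtain ⟨π, hπ, c, hc⟩ := WfDvdMonoid.exists_irreducible_factor (minpoly.not_isUnit F s)
    (minpoly.ne_zero hintegral)
  refine ⟨π, hπ, fun hker => ?_⟩
  have hc0 : aeval s c = 0 := by
    ext u
    have h0 : aeval s π (aeval s c u) = 0 := by
      rw [← Module.End.mul_apply, ← map_mul, ← hc, minpoly.aeval, LinearMap.zero_apply]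
    exact LinearMap.ker_eq_bot.1 hker (h0.trans (map_zero _).symm)
  have hdvd := minpoly.dvd F s hc0
  rw [hc] at hdvd
  have hc1 : c ≠ 0 := by
    rintro rfl
    exact minpoly.ne_zero hintegral (by rw [hc, mul_zero])
  obtain ⟨d, hd⟩ := hdvd
  refine hπ.not_isUnit (IsUnit.of_mul_eq_one d (mul_right_cancel₀ hc1 ?_))
  rw [one_mul]
  conv_rhs => rw [hd]
  ring

namespace IsSemisimpleIsom

variable {U : Type} [AddCommGroup U] [Module F U]
variable {B : LinearMap.BilinForm F U} {s : Module.End F U} {N : ℕ}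

theorem pow_pred_pow_pred (h : IsSemisimpleIsom B s N) : (s ^ (N - 1)) ^ (N - 1) = s := by
  have h1 : s * s ^ (N - 1) = 1 := by rw [mul_pow_sub_one h.pos.ne', h.pow_eq_one]
  have h2 : s ^ (N - 1) * s = 1 := by rw [pow_sub_one_mul h.pos.ne', h.pow_eq_one]
  have h3 : (s ^ (N - 1)) ^ (N - 1) * s ^ (N - 1) = 1 := by
    rw [pow_sub_one_mul h.pos.ne', ← pow_mul, mul_comm, pow_mul, h.pow_eq_one, one_pow]
  calc (s ^ (N - 1)) ^ (N - 1) = (s ^ (N - 1)) ^ (N - 1) * (s ^ (N - 1) * s) := by rw [h2, mul_one]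
    _ = s := by rw [← mul_assoc, h3, one_mul]

variable [Fintype F] [FiniteDimensional F U]

theorem exists_centIsom_mulEquiv_GL [Nontrivial U] {p f : ℕ} [Fact p.Prime]
    (hF : Fintype.card F = p ^ f) (h : IsSemisimpleIsom B s N) {π : F[X]} (hπ : Irreducible π)
    (hcop : IsCoprime π (π.comp (X ^ (N - 1)))) (hs : aeval s (π * π.comp (X ^ (N - 1))) = 0) :
    ∃ κ a, 0 < κ ∧ 0 < a ∧ finrank F U = 2 * (κ * a) ∧
      Nonempty (centIsom B s ≃* GL (Fin a) (GaloisField p (f * κ))) ∧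
      ∀ g ∈ centIsom B s, LinearEquiv.det g = 1 := by
  set π' := π.comp (X ^ (N - 1)) with hπ'
  have hc : IsCompl (LinearMap.ker (aeval s π)) (LinearMap.ker (aeval s π')) := by
    refine ⟨Polynomial.disjoint_ker_aeval_of_isCoprime s hcop, codisjoint_iff.2 ?_⟩
    rw [Polynomial.sup_ker_aeval_eq_ker_aeval_mul_of_coprime s hcop, hs, LinearMap.ker_zero]
  obtain ⟨c, d, hcd⟩ := hcop
  have hcd' : ∀ u, aeval s π (aeval s c u) + aeval s π' (aeval s d u) = u := by
    intro u
    have := congrArg (fun q => aeval s q u) hcd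
    simpa [mul_comm c, mul_comm d] using this
  have hker : ∀ (f : Module.End F U) (q : F[X]), Commute f s → ∀ w ∈ LinearMap.ker (aeval s q),
      f w ∈ LinearMap.ker (aeval s q) := by
    intro f q hf w hw
    rw [LinearMap.mem_ker] at hw ⊢
    have hcomm : Commute f (aeval s q) :=
      Algebra.commute_of_mem_adjoin_singleton_of_commute (R := F)
        (aeval_mem_adjoin_singleton F s) hf
    have := LinearMap.congr_fun hcomm w
    simp only [Module.End.mul_apply] at this
    rw [← this, hw, map_zero]
  have hpoly : ∀ q r : F[X], ∀ w ∈ LinearMap.ker (aeval s q),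
      aeval s r w ∈ LinearMap.ker (aeval s q) := fun q r =>
    hker _ q (by simpa using Commute.map (Commute.all r X) (aeval s))
  have hW : ∀ w ∈ LinearMap.ker (aeval s π), ∀ x ∈ LinearMap.ker (aeval s π), B w x = 0 := by
    intro w hw x hx
    rw [← hcd' x, LinearMap.mem_ker.1 (hpoly π c x hx), zero_add, ← h.aeval_apply_left,
      LinearMap.mem_ker.1 hw, map_zero, LinearMap.zero_apply]
  have hW' : ∀ w ∈ LinearMap.ker (aeval s π'), ∀ x ∈ LinearMap.ker (aeval s π'), B w x = 0 := by
    intro w hw x hx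
    rw [← hcd' x, LinearMap.mem_ker.1 (hpoly π' d x hx), add_zero, h.symm, h.aeval_apply_left,
      LinearMap.mem_ker.1 hw, map_zero]
  have hcent : ∀ g ∈ centIsom B s, Commute (g : Module.End F U) s := fun g hg =>
    LinearMap.ext hg.2
  obtain ⟨⟨e⟩, hdet⟩ := h.exists_centIsom_mulEquiv_of_isotropic hc hW hW'
    (hker s π (Commute.refl s)) (hker s π' (Commute.refl s)) (fun g hg => hker g π (hcent g hg))
    (fun g hg => hker g π' (hcent g hg))
  obtain ⟨hrank, -⟩ := h.exists_dual_equiv hc hW hW'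
  have hpos : 0 < finrank F U := finrank_pos
  have : Nontrivial (LinearMap.ker (aeval s π)) := nontrivial_of_finrank_pos (R := F) (by omega)
  obtain ⟨κ, a, hκ, ha, hr, ⟨e'⟩⟩ := exists_centIsom_zero_mulEquiv_GL hF hπ
    (s := s.restrict (hker s π (Commute.refl s)))
    (LinearMap.ext fun w => Subtype.ext ((coe_aeval_restrict _ _ _).trans w.2))
  exact ⟨κ, a, hκ, ha, by rw [hrank, hr], ⟨e.trans e'⟩, hdet⟩

/-- A nonzero invariant orthogonal summand on which the centralizer is a general linear or a
unitary group. -/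
theorem exists_block [Nontrivial U] {p f : ℕ} [Fact p.Prime] (hF : Fintype.card F = p ^ f)
    (h : IsSemisimpleIsom B s N) (hchar : (2 : F) ≠ 0) (hne : ∀ u, s (s u) = u → u = 0) :
    ∃ q : F[X], LinearMap.ker (aeval s q) ≤ LinearMap.ker (aeval s (q.comp (X ^ (N - 1)))) ∧
      ∀ hs : ∀ w ∈ LinearMap.ker (aeval s q), s w ∈ LinearMap.ker (aeval s q),
        IsSemisimpleIsom (B.restrict (LinearMap.ker (aeval s q))) (s.restrict hs) N →
        ∃ κ a α, 0 < κ ∧ 0 < a ∧ finrank F (LinearMap.ker (aeval s q)) = 2 * (κ * a) ∧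
          Nonempty (centIsom (B.restrict (LinearMap.ker (aeval s q))) (s.restrict hs) ≃*
            GLsign p α a (f * κ)) ∧
          ∀ g ∈ centIsom (B.restrict (LinearMap.ker (aeval s q))) (s.restrict hs),
            LinearEquiv.det g = 1 := by
  obtain ⟨π, hπ, hker⟩ := exists_irreducible_ker_aeval_ne_bot s
  by_cases hdvd : π ∣ π.comp (X ^ (N - 1))
  · refine ⟨π, ker_aeval_le_ker_aeval_of_dvd s hdvd, fun hs h' => ?_⟩
    have : Nontrivial (LinearMap.ker (aeval s π)) := Submodule.nontrivial_iff_ne_bot.2 hker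
    obtain ⟨κ, a, hκ, ha, hr, ⟨e⟩, hdet⟩ := exists_centIsom_mulEquiv_GUGroup hF h' hchar hπ hdvd
      (LinearMap.ext fun w => Subtype.ext ((coe_aeval_restrict _ _ _).trans w.2))
      (fun u hu => Subtype.ext (hne u (congrArg Subtype.val hu)))
    exact ⟨κ, a, false, hκ, ha, hr, ⟨e⟩, hdet⟩
  · set π' := π.comp (X ^ (N - 1)) with hπ'
    refine ⟨π * π', ?_, fun hs h' => ?_⟩
    · have : aeval s ((π * π').comp (X ^ (N - 1))) = aeval s (π * π') := by
        rw [mul_comp, mul_comm, map_mul, map_mul, hπ', comp_assoc, aeval_comp, aeval_comp]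
        congr 2
        simp [h.pow_pred_pow_pred]
      rw [this]
    · have : Nontrivial (LinearMap.ker (aeval s (π * π'))) := by
        rw [Submodule.nontrivial_iff_ne_bot]
        intro hbot
        refine hker (le_bot_iff.1 (hbot ▸ ker_aeval_le_ker_aeval_of_dvd s (dvd_mul_right π π')))
      obtain ⟨κ, a, hκ, ha, hr, ⟨e⟩, hdet⟩ := h'.exists_centIsom_mulEquiv_GL hF hπ
        ((hπ.coprime_iff_not_dvd).2 hdvd)
        (LinearMap.ext fun w => Subtype.ext ((coe_aeval_restrict _ _ _).trans w.2))
      exact ⟨κ, a, true, hκ, ha, hr, ⟨e⟩, hdet⟩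

end IsSemisimpleIsom

end Blocks

/-- `Fin.cons` as an isomorphism of groups. -/
def consMulEquiv {t : ℕ} (M : Fin (t + 1) → Type*) [∀ i, Group (M i)] :
    M 0 × (∀ i : Fin t, M i.succ) ≃* ∀ i, M i where
  toEquiv := Fin.consEquiv M
  map_mul' x y := by
    funext i
    refine Fin.cases ?_ (fun i => ?_) i <;> simp

theorem IsSemisimpleIsom.exists_centIsom_mulEquiv_pi {F : Type} [Field F] [Fintype F] {p f N : ℕ}
    [Fact p.Prime] (hF : Fintype.card F = p ^ f) (hchar : (2 : F) ≠ 0) :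
    ∀ (d : ℕ) (U : Type) [AddCommGroup U] [Module F U] [FiniteDimensional F U]
      (B : LinearMap.BilinForm F U) (s : Module.End F U), finrank F U = d →
      IsSemisimpleIsom B s N → (∀ u, s (s u) = u → u = 0) →
      ∃ (t : ℕ) (a κ : Fin t → ℕ) (α : Fin t → Bool), (∀ i, 0 < a i) ∧ (∀ i, 0 < κ i) ∧
        finrank F U = 2 * ∑ i, κ i * a i ∧
        Nonempty (centIsom B s ≃* ((i : Fin t) → GLsign p (α i) (a i) (f * κ i))) ∧
        ∀ g ∈ centIsom B s, LinearEquiv.det g = 1 := by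
  intro d
  induction d using Nat.strong_induction_on with
  | _ d ih =>
  intro U _ _ _ B s hd h hne
  rcases subsingleton_or_nontrivial U with hU | hU
  · refine ⟨0, Fin.elim0, Fin.elim0, Fin.elim0, fun i => i.elim0, fun i => i.elim0, ?_, ?_, ?_⟩
    · simp [finrank_zero_of_subsingleton]
    · have : Unique (centIsom B s) :=
        { default := 1, uniq := fun g => Subtype.ext (LinearEquiv.ext fun u => Subsingleton.elim _ _) }
      exact ⟨MulEquiv.ofUnique⟩
    · intro g _
      rw [Subsingleton.elim g 1, map_one]
  · obtain ⟨q, hq, hblock⟩ := h.exists_block hF hchar hne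
    obtain ⟨hs, hs', h₁, h₂, e, he, -⟩ := h.exists_split q hq
    obtain ⟨κ₀, a₀, α₀, hκ₀, ha₀, hr₀, ⟨e₀⟩, hdet₀⟩ := hblock hs h₁
    have hrank := (aeval s q).finrank_range_add_finrank_ker
    have hpos : 0 < κ₀ * a₀ := by positivity
    obtain ⟨t, a, κ, α, ha, hκ, hr, ⟨e₁⟩, hdet₁⟩ := ih _ (by omega) _ _ _ rfl h₂
      (fun u hu => Subtype.ext (hne u (congrArg Subtype.val hu)))
    refine ⟨t + 1, Fin.cons a₀ a, Fin.cons κ₀ κ, Fin.cons α₀ α, Fin.cases ha₀ ha,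
      Fin.cases hκ₀ hκ, ?_, ?_, ?_⟩
    · rw [Fin.sum_univ_succ]
      simp only [Fin.cons_zero, Fin.cons_succ]
      omega
    · exact ⟨(e.trans (e₀.prodCongr e₁)).trans (consMulEquiv fun i : Fin (t + 1) =>
        GLsign p ((Fin.cons α₀ α : Fin (t + 1) → Bool) i) ((Fin.cons a₀ a : Fin (t + 1) → ℕ) i)
          (f * (Fin.cons κ₀ κ : Fin (t + 1) → ℕ) i))⟩
    · intro g hg
      rw [he ⟨g, hg⟩, hdet₀ _ (e ⟨g, hg⟩).1.2, hdet₁ _ (e ⟨g, hg⟩).2.2, one_mul]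

/-- If `d` factors as `d₁ * d₂` on `G ≃* G₁ × G₂ × G₃` and `d₂` lifts along `d₁` to the centre of
`G₁`, then the kernel of `d` is `ker d₁ × G₂ × G₃`. -/
theorem nonempty_ker_mulEquiv_prod {G G₁ G₂ G₃ A : Type*} [Group G] [Group G₁] [Group G₂]
    [Group G₃] [CommGroup A] (e : G ≃* G₁ × G₂ × G₃) (d : G →* A) (d₁ : G₁ →* A) (d₂ : G₂ →* A)
    (hd : ∀ g, d g = d₁ (e g).1 * d₂ (e g).2.1) (c : G₂ →* G₁) (hc : ∀ g x, Commute (c g) x)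
    (hdc : ∀ g, d₁ (c g) = d₂ g) : Nonempty (d.ker ≃* d₁.ker × G₂ × G₃) := by
  refine ⟨{
    toFun := fun g => (⟨(e g).1 * c (e g).2.1, by
      rw [MonoidHom.mem_ker, map_mul, hdc, ← hd]
      exact g.2⟩, (e g).2)
    invFun := fun x => ⟨e.symm (x.1 * (c x.2.1)⁻¹, x.2), by
      rw [MonoidHom.mem_ker, hd, MulEquiv.apply_symm_apply, map_mul, map_inv, hdc,
        inv_mul_cancel_right]
      exact x.1.2⟩
    left_inv := fun g => ?_
    right_inv := fun x => ?_
    map_mul' := fun g g' => ?_ }⟩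
  · apply Subtype.ext
    simp
  · ext <;> simp
  · ext
    · simp only [Subgroup.coe_mul, map_mul, Prod.fst_mul, Prod.snd_mul]
      rw [mul_assoc, mul_assoc, ← mul_assoc _ (c _) (c _), ← (hc _ (e g').1).eq, mul_assoc]
    · simp
    · simp

section Forms

variable {F U : Type} [Field F] [AddCommGroup U] [Module F U] {m : ℕ}

/-- The group isomorphism from `GL (Fin m) F` to the linear automorphisms of `U` induced by a linear
isomorphism `F^m ≃ U`. -/
noncomputable def glEquiv (φ : (Fin m → F) ≃ₗ[F] U) : GL (Fin m) F ≃* (U ≃ₗ[F] U) :=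
  (Matrix.GeneralLinearGroup.toLin.trans (LinearMap.GeneralLinearGroup.congrLinearEquiv φ)).trans
    (LinearMap.GeneralLinearGroup.generalLinearEquiv F U)

theorem glEquiv_apply (φ : (Fin m → F) ≃ₗ[F] U) (g : GL (Fin m) F) (v : Fin m → F) :
    glEquiv φ g (φ v) = φ (g.val *ᵥ v) := by
  change φ (Matrix.toLin' g.val (φ.symm (φ v))) = _
  simp

theorem det_glEquiv (φ : (Fin m → F) ≃ₗ[F] U) (g : GL (Fin m) F) :
    LinearEquiv.det (glEquiv φ g) = Matrix.GeneralLinearGroup.det g := by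
  apply Units.ext
  have : ((glEquiv φ g : U ≃ₗ[F] U) : U →ₗ[F] U) =
      (φ : (Fin m → F) →ₗ[F] U) ∘ₗ Matrix.toLin' g.val ∘ₗ (φ.symm : U →ₗ[F] Fin m → F) := rfl
  rw [LinearEquiv.coe_det, this, LinearMap.det_conj, LinearMap.det_toLin']
  rfl

theorem mem_isomGroup_iff (hchar : (2 : F) ≠ 0) {B : LinearMap.BilinForm F U}
    (hsymm : ∀ u v, B u v = B v u) {Q : QuadraticForm F (Fin m → F)} (φ : (Fin m → F) ≃ₗ[F] U)
    {c : F} (hc : c ≠ 0) (hφ : ∀ v, B (φ v) (φ v) = c * Q v) (g : GL (Fin m) F) :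
    g ∈ isomGroup Q ↔ ∀ u v, B (glEquiv φ g u) (glEquiv φ g v) = B u v := by
  have hdiag : g ∈ isomGroup Q ↔ ∀ u, B (glEquiv φ g u) (glEquiv φ g u) = B u u := by
    rw [← φ.toEquiv.forall_congr_right]
    refine forall_congr' fun v => ?_
    simp only [LinearEquiv.coe_toEquiv, glEquiv_apply, hφ]
    exact (mul_right_inj' hc).symm
  rw [hdiag]
  refine ⟨fun h u v => ?_, fun h u => h u u⟩
  have h1 := h (u + v)
  simp only [map_add, LinearMap.add_apply, h u, h v, hsymm v u,
    hsymm (glEquiv φ g v) (glEquiv φ g u)] at h1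
  exact mul_left_cancel₀ hchar (by linear_combination h1)

theorem isNondegQF_of_bilinForm (hchar : (2 : F) ≠ 0) {B : LinearMap.BilinForm F U}
    (hsymm : ∀ u v, B u v = B v u) (hnd : ∀ u, (∀ v, B u v = 0) → u = 0)
    (φ : (Fin m → F) ≃ₗ[F] U) :
    IsNondegQF ((LinearMap.BilinMap.toQuadraticMap B).comp (φ : (Fin m → F) →ₗ[F] U)) := by
  intro v hv _
  apply φ.injective
  rw [map_zero]
  refine hnd _ fun u => ?_
  have h := hv (φ.symm u)
  have hp : QuadraticMap.polar
      (⇑((LinearMap.BilinMap.toQuadraticMap B).comp (φ : (Fin m → F) →ₗ[F] U))) v (φ.symm u) =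
      QuadraticMap.polar (⇑(LinearMap.BilinMap.toQuadraticMap B)) (φ v) u := by
    simp [QuadraticMap.polar]
  rw [hp, LinearMap.BilinMap.polar_toQuadraticMap, hsymm u, ← two_mul] at h
  exact (mul_eq_zero.1 h).resolve_left hchar

theorem polarBilin_nondegenerate (hchar : (2 : F) ≠ 0) {Q : QuadraticForm F (Fin m → F)}
    (hQ : IsNondegQF Q) : ∀ u, (∀ v, QuadraticMap.polarBilin Q u v = 0) → u = 0 := by
  intro u hu
  refine hQ u hu ?_
  have := hu u
  rw [QuadraticMap.polarBilin_apply_apply, QuadraticMap.polar_self] at this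
  simpa [hchar] using this

theorem nondegenerate_polarBilin (hchar : (2 : F) ≠ 0) {Q : QuadraticForm F (Fin m → F)}
    (hQ : IsNondegQF Q) : LinearMap.BilinForm.Nondegenerate (QuadraticMap.polarBilin Q) := by
  have hrefl : LinearMap.IsRefl (QuadraticMap.polarBilin Q) := fun u v h => by
    rw [QuadraticMap.polarBilin_apply_apply, QuadraticMap.polar_comm]
    exact h
  exact hrefl.nondegenerate_iff_separatingLeft.2 (polarBilin_nondegenerate hchar hQ)

theorem det_mul_det_eq_one_of_mem_isomGroup (hchar : (2 : F) ≠ 0) {Q : QuadraticForm F (Fin m → F)}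
    (hQ : IsNondegQF Q) {g : GL (Fin m) F} (hg : g ∈ isomGroup Q) :
    Matrix.GeneralLinearGroup.det g * Matrix.GeneralLinearGroup.det g = 1 := by
  have hnd := nondegenerate_polarBilin hchar hQ
  have hM := (LinearMap.BilinForm.nondegenerate_iff_det_ne_zero (Pi.basisFun F (Fin m))).1 hnd
  have hcomp : LinearMap.BilinForm.comp (QuadraticMap.polarBilin Q) (Matrix.toLin' g.val)
      (Matrix.toLin' g.val) =
      QuadraticMap.polarBilin Q := by
    refine LinearMap.ext₂ fun u v => ?_
    simp only [LinearMap.BilinForm.comp_apply, QuadraticMap.polarBilin_apply_apply,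
      QuadraticMap.polar, Matrix.toLin'_apply]
    rw [← Matrix.mulVec_add, hg, hg, hg]
  have h := congrArg (fun b => (LinearMap.BilinForm.toMatrix (Pi.basisFun F (Fin m)) b).det) hcomp
  simp only [LinearMap.BilinForm.toMatrix_comp (Pi.basisFun F (Fin m)) (Pi.basisFun F (Fin m)),
    Matrix.det_mul, Matrix.det_transpose, LinearMap.det_toMatrix, LinearMap.det_toLin'] at h
  apply Units.ext
  simp only [Units.val_mul, Matrix.GeneralLinearGroup.val_det_apply, Units.val_one]
  exact mul_right_cancel₀ hM (by linear_combination h)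

end Forms

section WittIndex

variable {F U : Type} [Field F] [AddCommGroup U] [Module F U]

theorem exists_ne_zero_polar_eq_zero (Q : QuadraticForm F U) (W : Submodule F U)
    [FiniteDimensional F W] (hW : 3 ≤ finrank F W) (x y : U) :
    ∃ z ∈ W, z ≠ 0 ∧ QuadraticMap.polar Q x z = 0 ∧ QuadraticMap.polar Q y z = 0 := by
  have hker : LinearMap.ker (((QuadraticMap.polarBilin Q x).prod
      (QuadraticMap.polarBilin Q y)).comp W.subtype) ≠ ⊥ :=
    LinearMap.ker_ne_bot_of_finrank_lt (by rw [finrank_prod, finrank_self]; omega)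
  obtain ⟨z, hz, hz0⟩ := Submodule.exists_mem_ne_zero_of_ne_bot hker
  rw [LinearMap.mem_ker] at hz
  exact ⟨z, z.2, by simpa using hz0, congrArg Prod.fst hz, congrArg Prod.snd hz⟩

/-- A quadratic form over a finite field of odd characteristic is isotropic on every subspace of
dimension at least three. -/
theorem exists_ne_zero_apply_eq_zero [Fintype F] (hodd : Fintype.card F % 2 = 1)
    (hchar : (2 : F) ≠ 0) (Q : QuadraticForm F U) (W : Submodule F U) [FiniteDimensional F W]
    (hW : 3 ≤ finrank F W) : ∃ z ∈ W, z ≠ 0 ∧ Q z = 0 := by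
  by_contra! hcon
  obtain ⟨x, hx, hx0, -⟩ := exists_ne_zero_polar_eq_zero Q W hW 0 0
  obtain ⟨y, hy, hy0, hxy, -⟩ := exists_ne_zero_polar_eq_zero Q W hW x x
  obtain ⟨z, hz, hz0, hxz, hyz⟩ := exists_ne_zero_polar_eq_zero Q W hW x y
  obtain ⟨a, b, hab⟩ := FiniteField.exists_root_sum_quadratic
    (f := C (Q x) * X ^ 2 + C 0 * X + C 0) (g := C (Q y) * X ^ 2 + C 0 * X + C (Q z))
    (degree_quadratic (hcon x hx hx0)) (degree_quadratic (hcon y hy hy0)) hodd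
  simp only [eval_add, eval_mul, eval_pow, eval_C, eval_X, zero_mul, add_zero] at hab
  have hadd : ∀ u v, QuadraticMap.polar Q u v = 0 → Q (u + v) = Q u + Q v := fun u v h => by
    rw [QuadraticMap.polar, sub_sub, sub_eq_zero] at h
    exact h
  have hz' : QuadraticMap.polar Q (a • x + b • y) z = 0 := by
    rw [QuadraticMap.polar_add_left, QuadraticMap.polar_smul_left, QuadraticMap.polar_smul_left,
      hxz, hyz, smul_zero, smul_zero, add_zero]
  refine hcon (a • x + b • y + z) (W.add_mem (W.add_mem (W.smul_mem _ hx) (W.smul_mem _ hy)) hz)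
    (fun h0 => ?_) ?_
  · have h1 : QuadraticMap.polar Q (a • x + b • y + z) z = 0 := by
      rw [h0, QuadraticMap.polar_zero_left]
    rw [QuadraticMap.polar_add_left, hz', zero_add, QuadraticMap.polar_self] at h1
    exact hcon z hz hz0 (by simpa [hchar] using h1)
  · rw [hadd _ _ hz', hadd, QuadraticMap.map_smul, QuadraticMap.map_smul]
    · simp only [smul_eq_mul]
      linear_combination hab
    · rw [QuadraticMap.polar_smul_left, QuadraticMap.polar_smul_right, hxy, smul_zero, smul_zero]

theorem exists_hasWittIndex [Fintype F] (hodd : Fintype.card F % 2 = 1) (hchar : (2 : F) ≠ 0)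
    {d : ℕ} {Q : QuadraticForm F (Fin (2 * d) → F)} (hQ : IsNondegQF Q) :
    ∃ ε : Bool, HasWittIndex Q (if ε then d else d - 1) := by
  have hnd := nondegenerate_polarBilin hchar hQ
  have hpolar : ∀ W : Submodule F (Fin (2 * d) → F), (∀ x ∈ W, Q x = 0) →
      W ≤ LinearMap.BilinForm.orthogonal (QuadraticMap.polarBilin Q) W := by
    intro W hW x hx y hy
    change QuadraticMap.polar Q y x = 0
    rw [QuadraticMap.polar, hW _ (W.add_mem hy hx), hW x hx, hW y hy, sub_zero, sub_zero]
  have hfin : ∀ W : Submodule F (Fin (2 * d) → F),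
      finrank F (LinearMap.BilinForm.orthogonal (QuadraticMap.polarBilin Q) W) =
        2 * d - finrank F W := fun W => by
    rw [LinearMap.BilinForm.finrank_orthogonal hnd, finrank_fin_fun]
  have hle : ∀ W : Submodule F (Fin (2 * d) → F), (∀ x ∈ W, Q x = 0) → finrank F W ≤ d := by
    intro W hW
    have h1 := Submodule.finrank_mono (hpolar W hW)
    have h2 := W.finrank_le
    rw [finrank_fin_fun] at h2
    rw [hfin] at h1
    omega
  set S : Set ℕ := {r : ℕ | ∃ W : Submodule F (Fin (2 * d) → F),
    (∀ x ∈ W, Q x = 0) ∧ finrank F W = r} with hS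
  have hbdd : ∀ r ∈ S, r ≤ d := by
    rintro r ⟨W, hW, rfl⟩
    exact hle W hW
  have hne : S.Nonempty := ⟨0, ⊥, by simp, by simp⟩
  have hmax : IsGreatest S (sSup S) :=
    ⟨Nat.sSup_mem hne ⟨d, hbdd⟩, fun r hr => le_csSup ⟨d, hbdd⟩ hr⟩
  have hge : d - 1 ≤ sSup S := by
    obtain ⟨W, hW, hWr⟩ := hmax.1
    by_contra! hlt
    obtain ⟨V, hV⟩ := exists_isCompl W
    set P := LinearMap.BilinForm.orthogonal (QuadraticMap.polarBilin Q) W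
    have hsup : W ⊔ V ⊓ P = P := by
      rw [← sup_inf_assoc_of_le V (hpolar W hW), hV.sup_eq_top, top_inf_eq]
    have hinf : W ⊓ (V ⊓ P) = ⊥ := by
      rw [← inf_assoc, hV.inf_eq_bot, bot_inf_eq]
    have hdim := Submodule.finrank_sup_add_finrank_inf_eq W (V ⊓ P)
    have hPdim : finrank F P = 2 * d - finrank F W := hfin W
    rw [hsup, hinf, finrank_bot, hPdim] at hdim
    obtain ⟨z, hz, hz0, hQz⟩ := exists_ne_zero_apply_eq_zero hodd hchar Q (V ⊓ P) (by omega)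
    have hzW : z ∉ W := fun h => hz0 ((Submodule.mem_bot F).1 (hinf ▸ ⟨h, hz⟩))
    have hdim' := Submodule.finrank_sup_add_finrank_inf_eq W (F ∙ z)
    have hdisj : W ⊓ (F ∙ z) = ⊥ :=
      (Submodule.disjoint_span_singleton_of_notMem hzW).eq_bot
    rw [hdisj, finrank_bot, finrank_span_singleton hz0] at hdim'
    have hmem : finrank F ↥(W ⊔ (F ∙ z)) ∈ S := by
      refine ⟨_, fun x hx => ?_, rfl⟩
      obtain ⟨w, hw, y, hy, rfl⟩ := Submodule.mem_sup.1 hx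
      obtain ⟨c, rfl⟩ := Submodule.mem_span_singleton.1 hy
      have hwz : QuadraticMap.polar Q w (c • z) = 0 := by
        rw [QuadraticMap.polar_smul_right, show QuadraticMap.polar Q w z = 0 from hz.2 w hw,
          smul_zero]
      rw [QuadraticMap.polar, QuadraticMap.map_smul, hQz, hW w hw, smul_zero, sub_zero,
        sub_zero] at hwz
      exact hwz
    have := hmax.2 hmem
    omega
  have hup : sSup S ≤ d := hbdd _ hmax.1
  rcases Nat.lt_or_ge (sSup S) d with h | h
  · refine ⟨false, ?_⟩
    have : sSup S = d - 1 := by omega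
    simpa [HasWittIndex, ← this] using hmax
  · refine ⟨true, ?_⟩
    have : sSup S = d := by omega
    simpa [HasWittIndex, ← this] using hmax

end WittIndex

section Decomposition

variable {F U : Type} [Field F] [AddCommGroup U] [Module F U]

theorem mem_ker_aeval_X_sub_C {s : Module.End F U} {c : F} {u : U} :
    u ∈ LinearMap.ker (aeval s (X - C c)) ↔ s u = c • u := by
  simp [LinearMap.mem_ker, sub_eq_zero, algebraMap_end_apply]

theorem IsSemisimpleIsom.ker_aeval_X_sub_C_le {B : LinearMap.BilinForm F U} {s : Module.End F U}
    {N : ℕ} (h : IsSemisimpleIsom B s N) {c : F} (hc : c * c = 1) :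
    LinearMap.ker (aeval s (X - C c)) ≤
      LinearMap.ker (aeval s ((X - C c).comp (X ^ (N - 1)))) := by
  intro u hu
  rw [mem_ker_aeval_X_sub_C] at hu
  have h1 := h.pow_pred_apply u
  rw [hu, map_smul] at h1
  have h2 : (s ^ (N - 1)) u = c • u := by
    rw [← h1, smul_smul, hc, one_smul, h1]
  simp [h2, algebraMap_end_apply]

/-- The isometry group of a bilinear form, written in coordinates. -/
theorem IsSemisimpleIsom.exists_centIsom_mulEquiv_isomGroup [FiniteDimensional F U]
    (hchar : (2 : F) ≠ 0) {B : LinearMap.BilinForm F U} {s : Module.End F U} {N : ℕ}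
    (h : IsSemisimpleIsom B s N) {c : F} (hs : ∀ u, s u = c • u) {m : ℕ} (hm : finrank F U = m) :
    ∃ Q : QuadraticForm F (Fin m → F), IsNondegQF Q ∧ ∃ e : centIsom B s ≃* isomGroup Q,
      ∀ g : centIsom B s, LinearEquiv.det (g : U ≃ₗ[F] U) =
        Matrix.GeneralLinearGroup.det (e g : GL (Fin m) F) := by
  let φ : (Fin m → F) ≃ₗ[F] U := LinearEquiv.ofFinrankEq _ _ (by rw [finrank_fin_fun, hm])
  have hmem : ∀ g, g ∈ isomGroup ((LinearMap.BilinMap.toQuadraticMap B).comp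
      (φ : (Fin m → F) →ₗ[F] U)) ↔ glEquiv φ g ∈ centIsom B s := by
    intro g
    rw [mem_isomGroup_iff hchar h.symm φ one_ne_zero (fun v => (one_mul _).symm), mem_centIsom]
    exact (and_iff_left fun u => by rw [hs, hs, map_smul]).symm
  obtain ⟨e, he⟩ := exists_subgroup_mulEquiv (glEquiv φ) _ _ hmem
  refine ⟨_, isNondegQF_of_bilinForm hchar h.symm h.nondeg φ, e.symm, fun g => ?_⟩
  rw [← det_glEquiv φ, ← he, MulEquiv.apply_symm_apply]

theorem IsSemisimpleIsom.exists_centIsom_mulEquiv_prod_pi [Fintype F] [FiniteDimensional F U]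
    {p f N : ℕ} [Fact p.Prime] (hF : Fintype.card F = p ^ f) (hchar : (2 : F) ≠ 0)
    {B : LinearMap.BilinForm F U} {s : Module.End F U} (h : IsSemisimpleIsom B s N)
    (hfix : ∀ u, s u = u → u = 0) (σ : centIsom B s) (hσ : ∀ u, (σ : U ≃ₗ[F] U) u = s u) :
    ∃ (r t : ℕ) (a κ : Fin t → ℕ) (α : Fin t → Bool), (∀ i, 0 < a i) ∧ (∀ i, 0 < κ i) ∧
      finrank F U = r + 2 * ∑ i, κ i * a i ∧ LinearEquiv.det (σ : U ≃ₗ[F] U) = (-1) ^ r ∧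
      ∀ m, m = r → ∃ Q : QuadraticForm F (Fin m → F), IsNondegQF Q ∧
        ∃ e : centIsom B s ≃* isomGroup Q × ((i : Fin t) → GLsign p (α i) (a i) (f * κ i)),
          ∀ g : centIsom B s, LinearEquiv.det (g : U ≃ₗ[F] U) =
            Matrix.GeneralLinearGroup.det ((e g).1 : GL (Fin m) F) := by
  obtain ⟨hs, hs', h₁, h₂, e, hedet, he₁, -⟩ :=
    h.exists_split (X - C (-1)) (h.ker_aeval_X_sub_C_le (by ring))
  have hs₁ : ∀ u : LinearMap.ker (aeval s (X - C (-1))), s.restrict hs u = (-1 : F) • u :=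
    fun u => Subtype.ext (mem_ker_aeval_X_sub_C.1 u.2)
  have hfix₂ : ∀ u, s.restrict hs' (s.restrict hs' u) = u → u = 0 := by
    intro u hu
    have hu' : s (s u) = u := congrArg Subtype.val hu
    have hmem : s.restrict hs' u - u = 0 := by
      refine Subtype.ext ((Submodule.disjoint_def.1
        (h.isCompl_ker_range (X - C (-1))).disjoint) _ ?_ (SetLike.coe_mem _))
      rw [mem_ker_aeval_X_sub_C]
      simp [hu']
    exact Subtype.ext (hfix u (congrArg Subtype.val (sub_eq_zero.1 hmem)))
  obtain ⟨t, a, κ, α, ha, hκ, hdim₂, ⟨e₂⟩, hdet₂⟩ :=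
    exists_centIsom_mulEquiv_pi hF hchar _ _ _ _ rfl h₂ hfix₂
  have hrank := (aeval s (X - C (-1 : F))).finrank_range_add_finrank_ker
  have hneg : ((e σ).1.1 : _ →ₗ[F] _) = (-1 : F) • LinearMap.id :=
    LinearMap.ext fun w => Subtype.ext ((he₁ σ w).trans
      ((hσ w).trans (congrArg Subtype.val (hs₁ w))))
  refine ⟨finrank F (LinearMap.ker (aeval s (X - C (-1 : F)))), t, a, κ, α, ha, hκ, by omega, ?_, ?_⟩
  · rw [hedet, hdet₂ _ (e σ).2.2, mul_one]
    apply Units.ext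
    rw [LinearEquiv.coe_det, hneg, LinearMap.det_smul, LinearMap.det_id, mul_one]
    simp
  · rintro m rfl
    obtain ⟨Q, hQ, e₁, hdet₁⟩ := h₁.exists_centIsom_mulEquiv_isomGroup hchar hs₁ rfl
    refine ⟨Q, hQ, e.trans (e₁.prodCongr e₂), fun g => ?_⟩
    rw [hedet, hdet₁, hdet₂ _ (e g).2.2, mul_one]
    rfl

theorem IsSemisimpleIsom.exists_centIsom_mulEquiv_prod_prod [Fintype F] [FiniteDimensional F U]
    {p f n N : ℕ} [Fact p.Prime] (hF : Fintype.card F = p ^ f) (hchar : (2 : F) ≠ 0)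
    {B : LinearMap.BilinForm F U} {σ : U ≃ₗ[F] U} (h : IsSemisimpleIsom B (σ : U →ₗ[F] U) N)
    (hdim : finrank F U = 2 * n + 1) (hdet : LinearEquiv.det σ = 1) :
    ∃ (k m t : ℕ) (a κ : Fin t → ℕ) (α : Fin t → Bool),
      k ≤ m ∧ m ≤ n ∧ (∀ i, 0 < a i) ∧ (∀ i, 0 < κ i) ∧ (∑ i, κ i * a i) = n - m ∧
      ∃ (Q₁ : QuadraticForm F (Fin (2 * k + 1) → F))
        (Q₂ : QuadraticForm F (Fin (2 * (m - k)) → F)),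
        IsNondegQF Q₁ ∧ IsNondegQF Q₂ ∧
        ∃ e : centIsom B (σ : U →ₗ[F] U) ≃* isomGroup Q₁ × isomGroup Q₂ ×
            ((i : Fin t) → GLsign p (α i) (a i) (f * κ i)),
          ∀ g : centIsom B (σ : U →ₗ[F] U), LinearEquiv.det (g : U ≃ₗ[F] U) =
            Matrix.GeneralLinearGroup.det ((e g).1 : GL (Fin (2 * k + 1)) F) *
              Matrix.GeneralLinearGroup.det ((e g).2.1 : GL (Fin (2 * (m - k))) F) := by
  obtain ⟨hs, hs', h₁, h₂, e, hedet, he₁, he₂⟩ :=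
    h.exists_split (X - C 1) (h.ker_aeval_X_sub_C_le (one_mul 1))
  have hs₁ : ∀ u : LinearMap.ker (aeval (σ : U →ₗ[F] U) (X - C 1)),
      (σ : U →ₗ[F] U).restrict hs u = (1 : F) • u :=
    fun u => Subtype.ext (mem_ker_aeval_X_sub_C.1 u.2)
  have hfix : ∀ u, (σ : U →ₗ[F] U).restrict hs' u = u → u = 0 := by
    intro u hu
    refine Subtype.ext ((Submodule.disjoint_def.1
      (h.isCompl_ker_range (X - C (1 : F))).disjoint) _ ?_ u.2)
    rw [mem_ker_aeval_X_sub_C, one_smul]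
    exact congrArg Subtype.val hu
  let g₀ : centIsom B (σ : U →ₗ[F] U) := ⟨σ, h.isom, fun _ => rfl⟩
  have hg₀ : (e g₀).1.1 = 1 :=
    LinearEquiv.ext fun w => Subtype.ext ((he₁ g₀ w).trans (by
      simpa using congrArg Subtype.val (hs₁ w)))
  obtain ⟨r, t, a, κ, α, ha, hκ, hdim₂, hdet₂, hQe⟩ :=
    h₂.exists_centIsom_mulEquiv_prod_pi hF hchar hfix (e g₀).2
      (fun u => Subtype.ext (he₂ g₀ u))
  have hrank := (aeval (σ : U →ₗ[F] U) (X - C (1 : F))).finrank_range_add_finrank_ker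
  obtain ⟨r', rfl⟩ : Even r := by
    have hd := hedet g₀
    rw [show (g₀ : U ≃ₗ[F] U) = σ from rfl, hdet, hg₀, map_one, one_mul, hdet₂] at hd
    by_contra hodd
    rw [Nat.not_even_iff_odd] at hodd
    rw [hodd.neg_one_pow] at hd
    have hd' := congrArg Units.val hd
    rw [Units.val_neg, Units.val_one] at hd'
    exact hchar (by linear_combination hd')
  generalize hT : ∑ i, κ i * a i = T at hdim₂
  obtain ⟨Q₁, hQ₁, e₁, hdet₁⟩ := h₁.exists_centIsom_mulEquiv_isomGroup hchar hs₁
    (m := 2 * (n - r' - T) + 1) (by omega)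
  obtain ⟨Q₂, hQ₂, e₂, hdet₂⟩ := hQe (2 * (n - T - (n - r' - T))) (by omega)
  refine ⟨n - r' - T, n - T, t, a, κ, α, by omega, by omega, ha, hκ, by omega, Q₁, Q₂, hQ₁, hQ₂,
    e.trans (e₁.prodCongr e₂), fun g => ?_⟩
  rw [hedet, hdet₁, hdet₂]
  rfl

end Decomposition

theorem isSemisimpleIsom_polarBilin {F : Type} [Field F] {m N : ℕ} (hchar : (2 : F) ≠ 0)
    {Q : QuadraticForm F (Fin m → F)} (hQ : IsNondegQF Q) {s : GL (Fin m) F}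
    (hs : s ∈ isomGroup Q) (hN : s ^ N = 1) (hN0 : (N : F) ≠ 0) :
    IsSemisimpleIsom (QuadraticMap.polarBilin Q)
      (glEquiv (LinearEquiv.refl F (Fin m → F)) s : (Fin m → F) →ₗ[F] Fin m → F) N where
  symm u v := QuadraticMap.polar_comm Q u v
  nondeg := polarBilin_nondegenerate hchar hQ
  isom := (mem_isomGroup_iff hchar (fun u v => QuadraticMap.polar_comm Q u v) _ hchar
    (fun v => by simp) s).1 hs
  pow_eq_one := by
    refine LinearMap.ext fun v => ?_
    rw [Module.End.pow_apply, Module.End.one_apply]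
    have h : ∀ k : ℕ, (⇑(glEquiv (LinearEquiv.refl F (Fin m → F)) s))^[k] v =
        glEquiv (LinearEquiv.refl F (Fin m → F)) (s ^ k) v := by
      intro k
      induction k with
      | zero => simp
      | succ k ih => rw [Function.iterate_succ_apply', ih, pow_succ', map_mul]; rfl
    refine (h N).trans ?_
    rw [hN, map_one]
    rfl
  ne_zero := hN0

theorem mem_centralizer_inf_isomGroup_iff {F : Type} [Field F] {m : ℕ} (hchar : (2 : F) ≠ 0)
    (Q : QuadraticForm F (Fin m → F)) (s g : GL (Fin m) F) :
    g ∈ Subgroup.centralizer {s} ⊓ isomGroup Q ↔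
      glEquiv (LinearEquiv.refl F (Fin m → F)) g ∈ centIsom (QuadraticMap.polarBilin Q)
        (glEquiv (LinearEquiv.refl F (Fin m → F)) s : (Fin m → F) →ₗ[F] Fin m → F) := by
  rw [Subgroup.mem_inf, mem_centIsom, and_comm, mem_isomGroup_iff hchar
    (B := QuadraticMap.polarBilin Q) (fun u v => QuadraticMap.polar_comm Q u v) (LinearEquiv.refl F (Fin m → F)) hchar
    (fun v => by simp) g, Subgroup.mem_centralizer_singleton_iff]
  refine and_congr_right fun _ => ?_
  rw [← (glEquiv (LinearEquiv.refl F (Fin m → F))).injective.eq_iff, map_mul, map_mul,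
    LinearEquiv.ext_iff]
  rfl

/-- The kernel of a homomorphism restricted to a subgroup. -/
def kerCompSubtypeMulEquiv {G A : Type*} [Group G] [Group A] (d : G →* A) (P : Subgroup G) :
    (d.comp P.subtype).ker ≃* ↥(P ⊓ d.ker) where
  toFun g := ⟨g, g.1.2, g.2⟩
  invFun g := ⟨⟨g, g.2.1⟩, g.2.2⟩
  map_mul' _ _ := rfl

/-- The homomorphism `O(Q₂) → O(Q₁)` sending `g` to the scalar matrix `det g`. -/
def detScalarHom {F : Type} [Field F] {m m' : ℕ} (hchar : (2 : F) ≠ 0)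
    (Q₁ : QuadraticForm F (Fin m → F)) {Q₂ : QuadraticForm F (Fin m' → F)} (hQ₂ : IsNondegQF Q₂) :
    isomGroup Q₂ →* isomGroup Q₁ :=
  (((Matrix.GeneralLinearGroup.scalar (Fin m)).comp Matrix.GeneralLinearGroup.det).comp
    (isomGroup Q₂).subtype).codRestrict (isomGroup Q₁) fun g v => by
      have h := congrArg Units.val (det_mul_det_eq_one_of_mem_isomGroup hchar hQ₂ g.2)
      rw [Units.val_mul, Units.val_one] at h
      rw [Matrix.GeneralLinearGroup.val_det_apply] at h
      simp [QuadraticMap.map_smul, h]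

/-- Lemma 2.2: for `q = p^f` an odd prime power and a semisimple element `s` of
`SO_(2n+1)(q)` (the special isometry group of a nondegenerate quadratic form `Q` on
`F_q^(2n+1)`), the centralizers of `s` in `SO_(2n+1)(q)` and in `O_(2n+1)(q)` are isomorphic
to `SO_(2k+1)(q) × O^ε_(2(m-k))(q) × ∏ᵢ GL^(αᵢ)_(aᵢ)(q^(kᵢ))` and
`O_(2k+1)(q) × O^ε_(2(m-k))(q) × ∏ᵢ GL^(αᵢ)_(aᵢ)(q^(kᵢ))` respectively, with
`0 ≤ k ≤ m ≤ n` and `Σᵢ kᵢ aᵢ = n - m`. -/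
theorem so_odd_dim_semisimple_centralizer (p f n : ℕ) [Fact p.Prime] (hp : Odd p) (hf : 0 < f)
    (F : Type) [Field F] [Fintype F] (hF : Fintype.card F = p ^ f)
    (Q : QuadraticForm F (Fin (2 * n + 1) → F)) (hQ : IsNondegQF Q)
    (s : GL (Fin (2 * n + 1)) F) (hs : s ∈ sisomGroup Q)
    (hss : (orderOf s).Coprime p) :
    ∃ (k m t : ℕ) (a κ : Fin t → ℕ) (α : Fin t → Bool) (ε : Bool),
      k ≤ m ∧ m ≤ n ∧ (∀ i, 0 < a i) ∧ (∀ i, 0 < κ i) ∧ (∑ i, κ i * a i) = n - m ∧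
      ∃ (Q₁ : QuadraticForm F (Fin (2 * k + 1) → F))
        (Q₂ : QuadraticForm F (Fin (2 * (m - k)) → F)),
        IsNondegQF Q₁ ∧ IsNondegQF Q₂ ∧
        HasWittIndex Q₂ (if ε then m - k else m - k - 1) ∧
        Nonempty ((↥(Subgroup.centralizer {s} ⊓ sisomGroup Q)) ≃*
          (↥(sisomGroup Q₁) × ↥(isomGroup Q₂) ×
            ((i : Fin t) → GLsign p (α i) (a i) (f * κ i)))) ∧
        Nonempty ((↥(Subgroup.centralizer {s} ⊓ isomGroup Q)) ≃*
          (↥(isomGroup Q₁) × ↥(isomGroup Q₂) ×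
            ((i : Fin t) → GLsign p (α i) (a i) (f * κ i)))) := by
  have hp2 : p % 2 = 1 := Nat.odd_iff.1 hp
  have hodd : Fintype.card F % 2 = 1 := by rw [hF]; exact Nat.odd_iff.1 hp.pow
  have hcharP : CharP F p := charP_of_card_eq_prime_pow hF
  have hchar : (2 : F) ≠ 0 := by
    intro h
    have := (CharP.cast_eq_zero_iff F p 2).1 (by exact_mod_cast h)
    have := Nat.le_of_dvd two_pos this
    have := (Fact.out : p.Prime).two_le
    omega
  have hN0 : ((orderOf s : ℕ) : F) ≠ 0 := by
    rw [Ne, CharP.cast_eq_zero_iff F p]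
    exact fun h => (Fact.out : p.Prime).one_lt.ne' (Nat.eq_one_of_dvd_coprimes hss h dvd_rfl)
  obtain ⟨k, m, t, a, κ, α, hkm, hmn, ha, hκ, hsum, Q₁, Q₂, hQ₁, hQ₂, e, he⟩ :=
    (isSemisimpleIsom_polarBilin hchar hQ hs.1 (pow_orderOf_eq_one s)
      hN0).exists_centIsom_mulEquiv_prod_prod hF hchar (finrank_fin_fun F)
      ((det_glEquiv _ s).trans hs.2)
  obtain ⟨ε, hε⟩ := exists_hasWittIndex hodd hchar hQ₂
  obtain ⟨E, hE⟩ := exists_subgroup_mulEquiv (glEquiv (LinearEquiv.refl F (Fin (2 * n + 1) → F)))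
    _ _ (mem_centralizer_inf_isomGroup_iff hchar Q s)
  obtain ⟨e'⟩ := nonempty_ker_mulEquiv_prod (E.trans e)
    (Matrix.GeneralLinearGroup.det.comp (Subgroup.centralizer {s} ⊓ isomGroup Q).subtype)
    (Matrix.GeneralLinearGroup.det.comp (isomGroup Q₁).subtype)
    (Matrix.GeneralLinearGroup.det.comp (isomGroup Q₂).subtype)
    (fun g => by
      rw [MulEquiv.trans_apply, MonoidHom.comp_apply, MonoidHom.comp_apply, MonoidHom.comp_apply]
      exact (det_glEquiv _ _).symm.trans ((congrArg _ (hE g).symm).trans (he (E g))))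
    (detScalarHom hchar Q₁ hQ₂)
    (fun g x => Subtype.ext (Matrix.GeneralLinearGroup.scalar_commute _ x.1))
    (fun g => by
      have h := det_mul_det_eq_one_of_mem_isomGroup hchar hQ₂ g.2
      refine (Matrix.GeneralLinearGroup.det_scalar _).trans ?_
      rw [Fintype.card_fin, pow_succ, pow_mul, pow_two]
      exact (congrArg₂ _ ((congrArg (· ^ k) h).trans (one_pow k)) rfl).trans (one_mul _))
  refine ⟨k, m, t, a, κ, α, ε, hkm, hmn, ha, hκ, hsum, Q₁, Q₂, hQ₁, hQ₂, hε, ⟨?_⟩,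
    ⟨E.trans e⟩⟩
  refine ((MulEquiv.subgroupCongr (inf_assoc _ _ _).symm).trans
      (kerCompSubtypeMulEquiv _ _).symm).trans (e'.trans ?_)
  exact (kerCompSubtypeMulEquiv _ _).prodCongr (MulEquiv.refl _)
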